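/- For every A ∈ yℌ and B ∈ ℌx, there exist unique real sequences (a_n)_{n≥1} and (b_n)_{n≥1} such that the Dirichlet series L1(s) = ∑_{n≥1} a_n/n^s and L2(s) = ∑_{n≥1} b_n/n^s converge for every integer s ≥ 0 and Z(A(x+y)^s B) = L1(s) + s·L2(s) holds for every integer s ≥ 0. -/

import Mathlib

open scoped BigOperators

noncomputable section

/-- `ℌ = ℚ⟨x,y⟩`, the free noncommutative polynomial ring in two indeterminates,
realized as the free `ℚ`-algebra on `Bool` (`false ↦ x`, `true ↦ y`). -/
abbrev H : Type := FreeAlgebra ℚ Bool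

/-- The indeterminate `x`. -/
def Hx : H := FreeAlgebra.ι ℚ false

/-- The indeterminate `y`. -/
def Hy : H := FreeAlgebra.ι ℚ true

/-- The multiple zeta value `ζ(k₁,…,k_r) = ∑_{0<n₁<⋯<n_r} 1/(n₁^{k₁}⋯n_r^{k_r})`. -/
def MZV (r : ℕ) (k : Fin r → ℕ) : ℝ :=
  ∑' n : {n : Fin r → ℕ // (∀ i, 0 < n i) ∧ StrictMono n},
    ∏ i, (1 : ℝ) / (n.1 i : ℝ) ^ (k i)

/-- `Z : yℌx → ℝ` is the `ℚ`-linear map with `Z(y x^{k₁-1} ⋯ y x^{k_r-1}) = ζ(k₁,…,k_r)`.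
We encode it as a `ℚ`-linear map on all of `ℌ` whose values on the basis monomials
`y x^{k₁-1} ⋯ y x^{k_r-1}` (with `k_r ≥ 2`) of `yℌx` are the multiple zeta values;
these values determine `Z` uniquely on the subspace `yℌx`. -/
def IsZetaMap (Z : H →ₗ[ℚ] ℝ) : Prop :=
  ∀ (r : ℕ) (k : Fin (r + 1) → ℕ), (∀ i, 1 ≤ k i) → 2 ≤ k (Fin.last r) →
    Z ((List.ofFn fun i => Hy * Hx ^ (k i - 1)).prod) = MZV (r + 1) k

/-- The family `f(A,B) = (Z(A(x+y)^s B))_{s ≥ 0}`. -/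
def fam (Z : H →ₗ[ℚ] ℝ) (A B : H) : ℕ → ℝ := fun s => Z (A * (Hx + Hy) ^ s * B)

/-- The `ℚ`-bilinear product `◇` on `ℌ`, characterized by its recursive defining
properties (which determine it uniquely). -/
def IsDiamond (d : H →ₗ[ℚ] H →ₗ[ℚ] H) : Prop :=
  (∀ w, d w 1 = w) ∧ (∀ w, d 1 w = w) ∧
  (∀ w1 w2, d (Hx * w1) (Hx * w2) = Hx * d w1 (Hx * w2) - Hx * d (Hy * w1) w2) ∧
  (∀ w1 w2, d (Hx * w1) (Hy * w2) = Hx * d w1 (Hy * w2) + Hy * d (Hx * w1) w2) ∧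
  (∀ w1 w2, d (Hy * w1) (Hx * w2) = Hy * d w1 (Hx * w2) + Hx * d (Hy * w1) w2) ∧
  (∀ w1 w2, d (Hy * w1) (Hy * w2) = Hy * d w1 (Hy * w2) - Hy * d (Hx * w1) w2)

/-- The harmonic product `∗` on `ℌ`, characterized by its recursive defining
properties (which determine it uniquely). -/
def IsHarmonic (st : H →ₗ[ℚ] H →ₗ[ℚ] H) : Prop :=
  (∀ w, st w 1 = w) ∧ (∀ w, st 1 w = w) ∧
  (∀ w1 w2, st (Hx * w1) w2 = Hx * st w1 w2) ∧
  (∀ w1 w2, st w1 (Hx * w2) = Hx * st w1 w2) ∧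
  (∀ w1 w2, st (Hy * w1) (Hy * w2) = Hy * (st w1 (Hy * w2) + st (Hy * w1) w2 + Hx * st w1 w2))

/-- The anti-automorphism `τ` of `ℌ` interchanging `x` and `y`, characterized by
being `ℚ`-linear, anti-multiplicative, unital, and swapping the generators. -/
def IsTau (t : H →ₗ[ℚ] H) : Prop :=
  t 1 = 1 ∧ (∀ a b, t (a * b) = t b * t a) ∧ t Hx = Hy ∧ t Hy = Hx

/-- The automorphism `φ` of `ℌ` with `φ(x) = x + y` and `φ(y) = -y`. -/
def phi : H →ₐ[ℚ] H := FreeAlgebra.lift ℚ (fun b => if b then -Hy else Hx + Hy)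

/-- The automorphism `S₁` of `ℌ` with `S₁(x) = x` and `S₁(y) = x + y`. -/
def S1 : H →ₐ[ℚ] H := FreeAlgebra.lift ℚ (fun b => if b then Hx + Hy else Hx)

/-- The Dirichlet series `∑_{n ≥ 1} a_n / n^s` (with `a n` the coefficient indexed by
`n + 1`) converges to `L` at `s`, i.e. its partial sums tend to `L`. -/
def DSConv (a : ℕ → ℝ) (s : ℕ) (L : ℝ) : Prop :=
  Filter.Tendsto (fun N => ∑ n ∈ Finset.range N, a n / ((n : ℝ) + 1) ^ s)
    Filter.atTop (nhds L)


section Parts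

open MeasureTheory Set Filter Topology
open scoped ENNReal

/-! ### Integral operators on the real line -/

def opL (φ : ℝ → ℝ≥0∞) (α : ℝ) : ℝ≥0∞ := ∫⁻ ρ in Ioi (0:ℝ), φ (α - ρ)
def opR (φ : ℝ → ℝ≥0∞) (α : ℝ) : ℝ≥0∞ := ∫⁻ ρ in Ioi (0:ℝ), φ (α + ρ)
def opK (f g : ℝ → ℝ≥0∞) (τ : ℝ) : ℝ≥0∞ := ∫⁻ α, f α * g (α + τ)

def sE (α : ℝ) : ℝ≥0∞ := ENNReal.ofReal (Real.sigmoid α)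
def xE (α : ℝ) : ℝ≥0∞ := ENNReal.ofReal (1 - Real.sigmoid α)

lemma meas_sE : Measurable sE := continuous_sigmoid.measurable.ennreal_ofReal
lemma meas_xE : Measurable xE := (measurable_const.sub continuous_sigmoid.measurable).ennreal_ofReal

lemma sE_add_xE (α : ℝ) : sE α + xE α = 1 := by
  unfold sE xE
  rw [← ENNReal.ofReal_add (Real.sigmoid_nonneg α) (by linarith [Real.sigmoid_le_one α])]
  simp

lemma meas_opL {φ : ℝ → ℝ≥0∞} (h : Measurable φ) : Measurable (opL φ) := by
  unfold opL
  exact Measurable.lintegral_prod_right' (f := fun p : ℝ × ℝ => φ (p.1 - p.2)) (by fun_prop)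

lemma meas_opR {φ : ℝ → ℝ≥0∞} (h : Measurable φ) : Measurable (opR φ) := by
  unfold opR
  exact Measurable.lintegral_prod_right' (f := fun p : ℝ × ℝ => φ (p.1 + p.2)) (by fun_prop)

lemma meas_opK {f g : ℝ → ℝ≥0∞} (hf : Measurable f) (hg : Measurable g) :
    Measurable (opK f g) := by
  unfold opK
  exact Measurable.lintegral_prod_right'
    (f := fun p : ℝ × ℝ => f p.2 * g (p.2 + p.1)) (by fun_prop)

lemma opK_L {f g : ℝ → ℝ≥0∞} (hf : Measurable f) (hg : Measurable g) :
    opK (opL f) g = opR (opK f g) := by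
  funext τ
  unfold opK opL opR
  have h1 : ∀ α, (∫⁻ ρ in Ioi (0:ℝ), f (α - ρ)) * g (α + τ)
      = ∫⁻ ρ in Ioi (0:ℝ), f (α - ρ) * g (α + τ) := fun α =>
    (lintegral_mul_const _ (by fun_prop)).symm
  simp_rw [h1]
  rw [lintegral_lintegral_swap (by fun_prop)]
  refine lintegral_congr fun ρ => ?_
  rw [← lintegral_add_right_eq_self _ ρ]
  refine lintegral_congr fun α => ?_
  congr 2 <;> ring

lemma opK_R {f g : ℝ → ℝ≥0∞} (hf : Measurable f) (hg : Measurable g) :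
    opK f (opR g) = opR (opK f g) := by
  funext τ
  unfold opK opR
  have h1 : ∀ α, f α * (∫⁻ ρ in Ioi (0:ℝ), g (α + τ + ρ))
      = ∫⁻ ρ in Ioi (0:ℝ), f α * g (α + τ + ρ) := fun α =>
    (lintegral_const_mul _ (by fun_prop)).symm
  simp_rw [h1]
  rw [lintegral_lintegral_swap (by fun_prop)]
  refine lintegral_congr fun ρ => ?_
  refine lintegral_congr fun α => ?_
  congr 2; ring

/-! ### Algebraic relations for the kernel -/

lemma sig_rel (α τ : ℝ) : (Real.exp τ - 1) * (Real.sigmoid α * (1 - Real.sigmoid (α + τ)))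
    = Real.sigmoid (α + τ) - Real.sigmoid α := by
  simp only [Real.sigmoid_def]
  rw [show -(α + τ) = -α + -τ by ring, Real.exp_add, Real.exp_neg τ]
  have h1 := Real.exp_pos (-α)
  have h2 := Real.exp_pos τ
  field_simp
  ring

lemma sE_rel (α τ : ℝ) (hτ : 0 ≤ τ) :
    ENNReal.ofReal (Real.exp τ - 1) * (sE α * xE (α + τ)) + sE α = sE (α + τ) := by
  unfold sE xE
  have h1 := Real.sigmoid_nonneg α
  have h2 : 0 ≤ 1 - Real.sigmoid (α + τ) := by linarith [Real.sigmoid_le_one (α + τ)]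
  have h3 : 0 ≤ Real.exp τ - 1 := by linarith [Real.add_one_le_exp τ]
  rw [← ENNReal.ofReal_mul h1, ← ENNReal.ofReal_mul h3, ← ENNReal.ofReal_add (by positivity) h1,
    sig_rel]
  congr 1; ring

lemma xE_rel (α τ : ℝ) (hτ : 0 ≤ τ) :
    ENNReal.ofReal (Real.exp τ - 1) * (sE α * xE (α + τ)) + xE (α + τ) = xE α := by
  unfold sE xE
  have h1 := Real.sigmoid_nonneg α
  have h2 : 0 ≤ 1 - Real.sigmoid (α + τ) := by linarith [Real.sigmoid_le_one (α + τ)]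
  have h3 : 0 ≤ Real.exp τ - 1 := by linarith [Real.add_one_le_exp τ]
  rw [← ENNReal.ofReal_mul h1, ← ENNReal.ofReal_mul h3, ← ENNReal.ofReal_add (by positivity) h2,
    sig_rel]
  congr 1; ring

lemma opK_add_right {f g h : ℝ → ℝ≥0∞} (hf : Measurable f) (hg : Measurable g) (τ : ℝ) :
    opK f (fun α => g α + h α) τ = opK f g τ + opK f h τ := by
  unfold opK
  rw [← lintegral_add_left (by fun_prop)]
  refine lintegral_congr fun α => by ring

lemma rel_gen {F G : ℝ → ℝ≥0∞} (hF : Measurable F) (hG : Measurable G) (τ : ℝ) (hτ : 0 ≤ τ) :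
    ENNReal.ofReal (Real.exp τ - 1) * opK (fun α => sE α * F α) (fun α => xE α * G α) τ
      + opK (fun α => sE α * F α) G τ + opK F (fun α => xE α * G α) τ = opK F G τ := by
  have hs := meas_sE
  have hx := meas_xE
  unfold opK
  rw [← lintegral_const_mul _ (by fun_prop), ← lintegral_add_left (by fun_prop),
    ← lintegral_add_left (by fun_prop)]
  refine lintegral_congr fun α => ?_
  calc _ = (ENNReal.ofReal (Real.exp τ - 1) * (sE α * xE (α + τ)) + sE α + xE (α + τ))
        * (F α * G (α + τ)) := by ring
    _ = _ := by rw [sE_rel α τ hτ, sE_add_xE, one_mul]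

lemma rel_left {G : ℝ → ℝ≥0∞} (hG : Measurable G) (τ : ℝ) (hτ : 0 ≤ τ) :
    ENNReal.ofReal (Real.exp τ - 1) * opK sE (fun α => xE α * G α) τ
      + opK sE G τ = opK sE G 0 := by
  have hs := meas_sE
  have hx := meas_xE
  unfold opK
  rw [← lintegral_const_mul _ (by fun_prop), ← lintegral_add_left (by fun_prop),
    ← lintegral_add_right_eq_self (fun α => sE α * G (α + 0)) τ]
  refine lintegral_congr fun α => ?_
  calc _ = (ENNReal.ofReal (Real.exp τ - 1) * (sE α * xE (α + τ)) + sE α)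
        * (G (α + τ)) := by ring
    _ = _ := by rw [sE_rel α τ hτ, add_zero]

lemma rel_right {F : ℝ → ℝ≥0∞} (hF : Measurable F) (τ : ℝ) (hτ : 0 ≤ τ) :
    ENNReal.ofReal (Real.exp τ - 1) * opK (fun α => sE α * F α) xE τ
      + opK F xE τ = opK F xE 0 := by
  have hs := meas_sE
  have hx := meas_xE
  unfold opK
  rw [← lintegral_const_mul _ (by fun_prop), ← lintegral_add_left (by fun_prop)]
  refine lintegral_congr fun α => ?_
  calc _ = (ENNReal.ofReal (Real.exp τ - 1) * (sE α * xE (α + τ)) + xE (α + τ))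
        * (F α) := by ring
    _ = _ := by rw [xE_rel α τ hτ, add_zero, mul_comm]

/-! ### Elementary integrals -/

lemma tendsto_sigmoid_sub (α : ℝ) : Tendsto (fun ρ => Real.sigmoid (α - ρ)) atTop (𝓝 0) :=
  Real.tendsto_sigmoid_atBot.comp (tendsto_atBot_add_const_left _ α tendsto_neg_atTop_atBot)

lemma opL_pow (n : ℕ) (α : ℝ) :
    opL (fun α => xE α * sE α ^ (n + 1)) α
      = ENNReal.ofReal (Real.sigmoid α ^ (n + 1) / (n + 1)) := by
  unfold opL
  have hd : ∀ ρ ∈ Ici (0:ℝ), HasDerivAt (fun ρ => - (Real.sigmoid (α - ρ) ^ (n + 1) / (n + 1)))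
      ((1 - Real.sigmoid (α - ρ)) * Real.sigmoid (α - ρ) ^ (n + 1)) ρ := by
    intro ρ _
    have h1 : HasDerivAt (fun ρ => Real.sigmoid (α - ρ))
        (-(Real.sigmoid (α - ρ) * (1 - Real.sigmoid (α - ρ)))) ρ := by
      exact HasDerivAt.comp_const_sub α ρ (Real.hasDerivAt_sigmoid (α - ρ))
    have h2 := ((h1.pow (n + 1)).div_const ((n:ℝ) + 1)).neg
    refine h2.congr_deriv ?_
    have : (n:ℝ) + 1 ≠ 0 := by positivity
    push_cast
    field_simp
    try simp
    try ring
  have hn : ∀ ρ ∈ Ioi (0:ℝ), 0 ≤ (1 - Real.sigmoid (α - ρ)) * Real.sigmoid (α - ρ) ^ (n + 1) := by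
    intro ρ _
    have := Real.sigmoid_le_one (α - ρ)
    have := Real.sigmoid_nonneg (α - ρ)
    have : 0 ≤ 1 - Real.sigmoid (α - ρ) := by linarith
    positivity
  have ht : Tendsto (fun ρ => - (Real.sigmoid (α - ρ) ^ (n + 1) / ((n:ℝ) + 1))) atTop (𝓝 0) := by
    have := (((tendsto_sigmoid_sub α).pow (n + 1)).div_const ((n:ℝ) + 1)).neg
    simpa using this
  have hi := integrableOn_Ioi_deriv_of_nonneg' hd hn ht
  have hv := integral_Ioi_of_hasDerivAt_of_nonneg' hd hn ht
  have : ∀ ρ, xE (α - ρ) * sE (α - ρ) ^ (n + 1)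
      = ENNReal.ofReal ((1 - Real.sigmoid (α - ρ)) * Real.sigmoid (α - ρ) ^ (n + 1)) := by
    intro ρ
    unfold xE sE
    rw [ENNReal.ofReal_mul (by linarith [Real.sigmoid_le_one (α - ρ)]),
      ENNReal.ofReal_pow (Real.sigmoid_nonneg _)]
  simp_rw [this]
  rw [← ofReal_integral_eq_lintegral_ofReal hi ?_, hv]
  · simp
  · filter_upwards [ae_restrict_mem measurableSet_Ioi] with ρ hρ using hn ρ hρ

lemma opR_pow (n : ℕ) (α : ℝ) :
    opR (fun α => xE α * sE α ^ (n + 1)) α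
      = ENNReal.ofReal ((1 - Real.sigmoid α ^ (n + 1)) / (n + 1)) := by
  unfold opR
  have hd : ∀ ρ ∈ Ici (0:ℝ), HasDerivAt (fun ρ => (Real.sigmoid (α + ρ) ^ (n + 1) / (n + 1)))
      ((1 - Real.sigmoid (α + ρ)) * Real.sigmoid (α + ρ) ^ (n + 1)) ρ := by
    intro ρ _
    have h1 : HasDerivAt (fun ρ => Real.sigmoid (α + ρ))
        ((Real.sigmoid (α + ρ) * (1 - Real.sigmoid (α + ρ)))) ρ := by
      exact HasDerivAt.comp_const_add α ρ (Real.hasDerivAt_sigmoid (α + ρ))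
    have h2 := ((h1.pow (n + 1)).div_const ((n:ℝ) + 1))
    refine h2.congr_deriv ?_
    have : (n:ℝ) + 1 ≠ 0 := by positivity
    push_cast
    field_simp
    try simp
    try ring
  have hn : ∀ ρ ∈ Ioi (0:ℝ), 0 ≤ (1 - Real.sigmoid (α + ρ)) * Real.sigmoid (α + ρ) ^ (n + 1) := by
    intro ρ _
    have := Real.sigmoid_le_one (α + ρ)
    have := Real.sigmoid_nonneg (α + ρ)
    have : 0 ≤ 1 - Real.sigmoid (α + ρ) := by linarith
    positivity
  have ht : Tendsto (fun ρ => (Real.sigmoid (α + ρ) ^ (n + 1) / ((n:ℝ) + 1))) atTop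
      (𝓝 (1 / (n + 1))) := by
    have h0 : Tendsto (fun ρ => Real.sigmoid (α + ρ)) atTop (𝓝 1) :=
      Real.tendsto_sigmoid_atTop.comp (tendsto_atTop_add_const_left _ α tendsto_id)
    have := ((h0.pow (n + 1)).div_const ((n:ℝ) + 1))
    simpa using this
  have hi := integrableOn_Ioi_deriv_of_nonneg' hd hn ht
  have hv := integral_Ioi_of_hasDerivAt_of_nonneg' hd hn ht
  have : ∀ ρ, xE (α + ρ) * sE (α + ρ) ^ (n + 1)
      = ENNReal.ofReal ((1 - Real.sigmoid (α + ρ)) * Real.sigmoid (α + ρ) ^ (n + 1)) := by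
    intro ρ
    unfold xE sE
    rw [ENNReal.ofReal_mul (by linarith [Real.sigmoid_le_one (α + ρ)]),
      ENNReal.ofReal_pow (Real.sigmoid_nonneg _)]
  simp_rw [this]
  rw [← ofReal_integral_eq_lintegral_ofReal hi ?_, hv]
  · simp [sub_div]
  · filter_upwards [ae_restrict_mem measurableSet_Ioi] with ρ hρ using hn ρ hρ

lemma lintegral_split (φ : ℝ → ℝ≥0∞) : ∫⁻ α, φ α = opL φ 0 + opR φ 0 := by
  unfold opL opR
  rw [← lintegral_add_compl φ (measurableSet_Ioi (a := (0:ℝ))), add_comm]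
  congr 1
  · rw [compl_Ioi, ← lintegral_indicator measurableSet_Iic, ← lintegral_indicator measurableSet_Ioi,
      ← lintegral_neg_eq_self]
    refine lintegral_congr_ae ?_
    filter_upwards [compl_mem_ae_iff.mpr (measure_singleton (0:ℝ))] with ρ hρ
    have hρ' : ρ ≠ 0 := hρ
    by_cases h : 0 < ρ
    · rw [indicator_of_mem (by simp; exact h.le), indicator_of_mem (by simpa using h)]
      simp
    · rw [indicator_of_notMem (by
        simp only [mem_Iic]; push Not at h ⊢; have := lt_of_le_of_ne h hρ'; linarith),
        indicator_of_notMem (by simpa using h)]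
  · simp

lemma lintegral_pow (n : ℕ) : ∫⁻ α, xE α * sE α ^ (n + 1) = ENNReal.ofReal (1 / (n + 1)) := by
  rw [lintegral_split, opL_pow, opR_pow, ← ENNReal.ofReal_add]
  · congr 1; ring
  · have := Real.sigmoid_nonneg 0; positivity
  · have : Real.sigmoid 0 ^ (n + 1) ≤ 1 := pow_le_one₀ (Real.sigmoid_nonneg _) (Real.sigmoid_le_one _)
    have : 0 ≤ 1 - Real.sigmoid 0 ^ (n + 1) := by linarith
    positivity

/-- base case: `(e^τ - 1) K_{y,x}(τ) = τ`. -/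
lemma rel_base (τ : ℝ) (hτ : 0 ≤ τ) :
    ENNReal.ofReal (Real.exp τ - 1) * opK sE xE τ = ENNReal.ofReal τ := by
  have hs := meas_sE
  have hx := meas_xE
  have key : ∀ α, ENNReal.ofReal (Real.exp τ - 1) * (sE α * xE (α + τ))
      = ∫⁻ ρ in Ioc 0 τ, xE (α + ρ) * sE (α + ρ) ^ (0 + 1) := by
    intro α
    have h1 := Real.sigmoid_nonneg α
    have h2 : 0 ≤ 1 - Real.sigmoid (α + τ) := by linarith [Real.sigmoid_le_one (α + τ)]
    have h3 : 0 ≤ Real.exp τ - 1 := by linarith [Real.add_one_le_exp τ]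
    have e1 : ENNReal.ofReal (Real.exp τ - 1) * (sE α * xE (α + τ))
        = ENNReal.ofReal (Real.sigmoid (α + τ) - Real.sigmoid α) := by
      rw [← sig_rel]; unfold sE xE
      rw [← ENNReal.ofReal_mul h1, ← ENNReal.ofReal_mul h3]
    have hd : ∀ ρ ∈ uIcc 0 τ, HasDerivAt (fun ρ => Real.sigmoid (α + ρ))
        ((Real.sigmoid (α + ρ) * (1 - Real.sigmoid (α + ρ)))) ρ := by
      intro ρ _
      exact HasDerivAt.comp_const_add α ρ (Real.hasDerivAt_sigmoid (α + ρ))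
    have hc : Continuous fun ρ => Real.sigmoid (α + ρ) * (1 - Real.sigmoid (α + ρ)) := by
      have : Continuous fun ρ => Real.sigmoid (α + ρ) :=
        continuous_sigmoid.comp (continuous_const.add continuous_id)
      fun_prop
    have hv := intervalIntegral.integral_eq_sub_of_hasDerivAt hd (hc.intervalIntegrable _ _)
    rw [intervalIntegral.integral_of_le hτ] at hv
    rw [e1]
    simp only [add_zero] at hv
    rw [← hv, ofReal_integral_eq_lintegral_ofReal]
    · refine lintegral_congr fun ρ => ?_
      unfold xE sE
      rw [ENNReal.ofReal_mul (Real.sigmoid_nonneg _)]; ring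
    · exact (hc.integrableOn_Icc).mono_set Ioc_subset_Icc_self
    · refine ae_of_all _ fun ρ => mul_nonneg (Real.sigmoid_nonneg _) ?_
      linarith [Real.sigmoid_le_one (α + ρ)]
  unfold opK
  rw [← lintegral_const_mul _ (by fun_prop)]
  simp_rw [key]
  rw [lintegral_lintegral_swap (by fun_prop)]
  have : ∀ ρ, ∫⁻ α, xE (α + ρ) * sE (α + ρ) ^ (0 + 1) = 1 := by
    intro ρ
    rw [lintegral_add_right_eq_self (fun α => xE α * sE α ^ (0 + 1)) ρ, lintegral_pow]; simp
  simp_rw [this]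
  simp


/-! ### Exponential-Dirichlet expansions -/

def InE (k : ℝ → ℝ) (c d : ℕ → ℝ) : Prop :=
  (∃ C, 0 ≤ C ∧ ∀ n : ℕ, |c n| ≤ C / √((n:ℝ) + 1) ∧ |d n| ≤ C * √((n:ℝ) + 1)) ∧
  ∀ τ, 0 < τ → HasSum (fun n : ℕ => (c n + d n * τ) * Real.exp (-(((n:ℝ) + 1) * τ))) (k τ)

def InS (k : ℝ → ℝ) (c d : ℕ → ℝ) : Prop :=
  (∃ C, 0 ≤ C ∧ ∀ n : ℕ, |c n| ≤ C / (((n:ℝ) + 1) * √((n:ℝ) + 1)) ∧ |d n| ≤ C / √((n:ℝ) + 1)) ∧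
  ∀ τ, 0 ≤ τ → HasSum (fun n : ℕ => (c n + d n * τ) * Real.exp (-(((n:ℝ) + 1) * τ))) (k τ)

lemma one_le_sqrt_succ (n : ℕ) : 1 ≤ √((n:ℝ) + 1) := by
  rw [Real.one_le_sqrt]; linarith [(Nat.cast_nonneg n : (0:ℝ) ≤ n)]

lemma InS.toInE {k c d} (h : InS k c d) : InE k c d := by
  obtain ⟨⟨C, hC, hb⟩, hs⟩ := h
  refine ⟨⟨C, hC, fun n => ⟨(hb n).1.trans ?_, (hb n).2.trans ?_⟩⟩, fun τ hτ => hs τ hτ.le⟩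
  · have := one_le_sqrt_succ n
    apply div_le_div_of_nonneg_left hC (by positivity)
    have : (1:ℝ) ≤ (n:ℝ) + 1 := by linarith [(Nat.cast_nonneg n : (0:ℝ) ≤ n)]
    nlinarith
  · have := one_le_sqrt_succ n
    rw [div_le_iff₀ (by positivity)]
    have : 1 ≤ √((n:ℝ) + 1) * √((n:ℝ) + 1) := by nlinarith
    nlinarith

lemma InS.add {k c d k' c' d'} (h : InS k c d) (h' : InS k' c' d') :
    InS (fun τ => k τ + k' τ) (fun n => c n + c' n) (fun n => d n + d' n) := by
  obtain ⟨⟨C, hC, hb⟩, hs⟩ := h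
  obtain ⟨⟨C', hC', hb'⟩, hs'⟩ := h'
  refine ⟨⟨C + C', by positivity, fun n => ⟨?_, ?_⟩⟩, fun τ hτ => ?_⟩
  · rw [add_div]; exact (abs_add_le _ _).trans (add_le_add (hb n).1 (hb' n).1)
  · rw [add_div]; exact (abs_add_le _ _).trans (add_le_add (hb n).2 (hb' n).2)
  · convert (hs τ hτ).add (hs' τ hτ) using 2; ring

lemma InS.neg {k c d} (h : InS k c d) :
    InS (fun τ => - k τ) (fun n => - c n) (fun n => - d n) := by
  obtain ⟨⟨C, hC, hb⟩, hs⟩ := h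
  refine ⟨⟨C, hC, fun n => ?_⟩, fun τ hτ => ?_⟩
  · simpa using hb n
  · exact (hs τ hτ).neg.congr_fun fun n => by ring

lemma summable_three_half : Summable fun n : ℕ => 1 / (((n:ℝ) + 1) * √((n:ℝ) + 1)) := by
  have h := (summable_nat_add_iff 1).mpr
    (Real.summable_one_div_nat_rpow.mpr (show (1:ℝ) < 3/2 by norm_num))
  refine h.congr fun n => ?_
  have hp : (0:ℝ) < (n:ℝ) + 1 := by positivity
  push_cast
  rw [show (3/2:ℝ) = 1 + 1/2 by norm_num, Real.rpow_add hp, Real.rpow_one, ← Real.sqrt_eq_rpow]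

lemma sqrt_tail (N M : ℕ) :
    ∑ m ∈ Finset.range M, 1 / (((N + m : ℕ) + 1 : ℝ) * √((N + m : ℕ) + 1 : ℝ))
      ≤ 6 * (1 / √((N:ℝ) + 1)) - 6 * (1 / √((N + M : ℕ) + 1 : ℝ)) := by
  induction M with
  | zero => simp
  | succ M ih =>
    rw [Finset.sum_range_succ]
    have key : 1 / (((N + M : ℕ) + 1 : ℝ) * √((N + M : ℕ) + 1 : ℝ)) ≤
        6 * (1 / √((N + M : ℕ) + 1 : ℝ)) - 6 * (1 / √((N + (M + 1) : ℕ) + 1 : ℝ)) := by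
      have e : ((N + (M + 1) : ℕ) + 1 : ℝ) = ((N + M : ℕ) + 1 : ℝ) + 1 := by push_cast; ring
      rw [e]
      have ha : (1:ℝ) ≤ ((N + M : ℕ) + 1 : ℝ) := by
        linarith [(Nat.cast_nonneg (N + M) : (0:ℝ) ≤ ((N+M : ℕ):ℝ))]
      generalize ((N + M : ℕ) + 1 : ℝ) = a at ha
      set u := √a with hu
      set v := √(a + 1) with hv
      have hu2 : u * u = a := Real.mul_self_sqrt (by linarith)
      have hv2 : v * v = a + 1 := Real.mul_self_sqrt (by linarith)
      have hu1 : 1 ≤ u := Real.one_le_sqrt.mpr ha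
      have huv : u ≤ v := Real.sqrt_le_sqrt (by linarith)
      have hv3 : v ≤ 2 * u := by
        apply Real.sqrt_le_iff.mpr; constructor <;> nlinarith
      have hv1 : 1 ≤ v := by linarith
      have e2 : 6 * (1 / u) - 6 * (1 / v) = 6 * (v - u) / (u * v) := by
        field_simp
      rw [e2, div_le_div_iff₀ (by positivity) (by positivity), ← hu2]
      have h1 : (v - u) * (v + u) = 1 := by ring_nf; nlinarith
      have h2 : v + u ≤ 3 * u := by linarith
      have h3 : 1 ≤ (v - u) * (3 * u) := by
        rw [← h1]; exact mul_le_mul_of_nonneg_left h2 (by linarith)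
      have h4 : u * v ≤ 2 * (u * u) := by nlinarith
      calc 1 * (u * v) ≤ 2 * (u * u) := by linarith
        _ ≤ 2 * (u * u) * ((v - u) * (3 * u)) := le_mul_of_one_le_right (by positivity) h3
        _ = _ := by ring
    linarith

lemma sqrt_partial (N : ℕ) : ∑ m ∈ Finset.range N, 1 / √((m:ℝ) + 1) ≤ 2 * √(N:ℝ) := by
  induction N with
  | zero => simp
  | succ N ih =>
    rw [Finset.sum_range_succ]
    push_cast
    set u := √(N:ℝ)
    set v := √((N:ℝ) + 1)
    have hu2 : u * u = N := Real.mul_self_sqrt (by positivity)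
    have hv2 : v * v = N + 1 := Real.mul_self_sqrt (by positivity)
    have hv1 : 1 ≤ v := one_le_sqrt_succ N
    have hu : 0 ≤ u := Real.sqrt_nonneg _
    have huv : u ≤ v := Real.sqrt_le_sqrt (by linarith)
    have : 1 / v ≤ 2 * (v - u) := by
      rw [div_le_iff₀ (by positivity)]
      nlinarith
    linarith

/-! #### Integration -/

lemma expint_nonneg (p q τ N : ℝ) (hp : 0 ≤ p) (hq : 0 ≤ q) (hτ : 0 ≤ τ) (hN : 0 < N) :
    IntegrableOn (fun ρ => (p + q * (τ + ρ)) * Real.exp (-(N * (τ + ρ)))) (Ioi 0) := by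
  have hd : ∀ ρ ∈ Ici (0:ℝ), HasDerivAt
      (fun ρ => -((p / N + q / N ^ 2 + q / N * (τ + ρ)) * Real.exp (-(N * (τ + ρ)))))
      ((p + q * (τ + ρ)) * Real.exp (-(N * (τ + ρ)))) ρ := by
    intro ρ _
    have h1 : HasDerivAt (fun ρ => τ + ρ) 1 ρ := (hasDerivAt_id ρ).const_add τ
    have h2 := (h1.const_mul N).neg.exp
    have h3 := ((h1.const_mul (q / N)).const_add (p / N + q / N ^ 2))
    refine (h3.mul h2).neg.congr_deriv ?_
    simp only [Pi.neg_apply]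
    field_simp
    ring
  have ht : Tendsto (fun ρ => -((p / N + q / N ^ 2 + q / N * (τ + ρ)) * Real.exp (-(N * (τ + ρ)))))
      atTop (𝓝 0) := by
    have hx : Tendsto (fun ρ => N * (τ + ρ)) atTop atTop :=
      (tendsto_atTop_add_const_left _ τ tendsto_id).const_mul_atTop hN
    have h0 := (Real.tendsto_pow_mul_exp_neg_atTop_nhds_zero 0).comp hx
    have h1 := (Real.tendsto_pow_mul_exp_neg_atTop_nhds_zero 1).comp hx
    have := ((h0.const_mul (p / N + q / N ^ 2)).add (h1.const_mul (q / N ^ 2))).neg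
    simp only [mul_zero, add_zero, neg_zero] at this
    refine this.congr fun ρ => ?_
    simp
    field_simp
    try ring
  refine integrableOn_Ioi_deriv_of_nonneg' hd ?_ ht
  intro ρ hρ
  have : (0:ℝ) < ρ := hρ
  positivity

lemma expint_int (p q τ N : ℝ) (hτ : 0 ≤ τ) (hN : 0 < N) :
    IntegrableOn (fun ρ => (p + q * (τ + ρ)) * Real.exp (-(N * (τ + ρ)))) (Ioi 0) := by
  refine Integrable.mono' (expint_nonneg |p| |q| τ N (abs_nonneg _) (abs_nonneg _) hτ hN)
    (by fun_prop) ?_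
  filter_upwards [ae_restrict_mem measurableSet_Ioi] with ρ hρ
  have hρ' : (0:ℝ) < ρ := hρ
  rw [norm_mul, Real.norm_eq_abs, Real.norm_eq_abs, abs_of_pos (Real.exp_pos _)]
  refine mul_le_mul_of_nonneg_right ((abs_add_le _ _).trans ?_) (Real.exp_pos _).le
  rw [abs_mul, abs_of_nonneg (by positivity : 0 ≤ τ + ρ)]

lemma expint_eq (p q τ N : ℝ) (hτ : 0 ≤ τ) (hN : 0 < N) :
    ∫ ρ in Ioi (0:ℝ), (p + q * (τ + ρ)) * Real.exp (-(N * (τ + ρ)))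
      = (p / N + q / N ^ 2 + q / N * τ) * Real.exp (-(N * τ)) := by
  have hd : ∀ ρ ∈ Ici (0:ℝ), HasDerivAt
      (fun ρ => -((p / N + q / N ^ 2 + q / N * (τ + ρ)) * Real.exp (-(N * (τ + ρ)))))
      ((p + q * (τ + ρ)) * Real.exp (-(N * (τ + ρ)))) ρ := by
    intro ρ _
    have h1 : HasDerivAt (fun ρ => τ + ρ) 1 ρ := (hasDerivAt_id ρ).const_add τ
    have h2 := (h1.const_mul N).neg.exp
    have h3 := ((h1.const_mul (q / N)).const_add (p / N + q / N ^ 2))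
    refine (h3.mul h2).neg.congr_deriv ?_
    simp only [Pi.neg_apply]
    field_simp
    ring
  have ht : Tendsto (fun ρ => -((p / N + q / N ^ 2 + q / N * (τ + ρ)) * Real.exp (-(N * (τ + ρ)))))
      atTop (𝓝 0) := by
    have hx : Tendsto (fun ρ => N * (τ + ρ)) atTop atTop :=
      (tendsto_atTop_add_const_left _ τ tendsto_id).const_mul_atTop hN
    have h0 := (Real.tendsto_pow_mul_exp_neg_atTop_nhds_zero 0).comp hx
    have h1 := (Real.tendsto_pow_mul_exp_neg_atTop_nhds_zero 1).comp hx
    have := ((h0.const_mul (p / N + q / N ^ 2)).add (h1.const_mul (q / N ^ 2))).neg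
    simp only [mul_zero, add_zero, neg_zero] at this
    refine this.congr fun ρ => ?_
    simp
    field_simp
    try ring
  rw [integral_Ioi_of_hasDerivAt_of_tendsto' hd (expint_int p q τ N hτ hN) ht]
  simp

lemma lemD {K : ℝ → ℝ≥0∞} (hK : Measurable K) (hfin : ∀ τ, 0 < τ → K τ ≠ ⊤) {c d : ℕ → ℝ}
    (h : InE (fun τ => (K τ).toReal) c d) :
    (∀ τ, 0 ≤ τ → opR K τ ≠ ⊤) ∧
    InS (fun τ => (opR K τ).toReal) (fun n => c n / ((n:ℝ) + 1) + d n / ((n:ℝ) + 1) ^ 2)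
      (fun n => d n / ((n:ℝ) + 1)) := by
  obtain ⟨⟨C, hC, hb⟩, hs⟩ := h
  have hbound : ∀ n : ℕ, |c n| / ((n:ℝ) + 1) ≤ C * (1 / (((n:ℝ) + 1) * √((n:ℝ) + 1))) ∧
      |d n| / ((n:ℝ) + 1) ^ 2 ≤ C * (1 / (((n:ℝ) + 1) * √((n:ℝ) + 1))) := by
    intro n
    have hu := one_le_sqrt_succ n
    have hu2 : √((n:ℝ) + 1) * √((n:ℝ) + 1) = (n:ℝ) + 1 := Real.mul_self_sqrt (by positivity)
    have hN : (0:ℝ) < (n:ℝ) + 1 := by positivity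
    constructor
    · rw [div_le_iff₀ hN]
      refine (hb n).1.trans (le_of_eq ?_)
      field_simp
    · rw [div_le_iff₀ (by positivity)]
      refine (hb n).2.trans (le_of_eq ?_)
      rw [mul_assoc]; congr 1
      field_simp
      rw [pow_two, hu2]
  -- integrals of norms
  have hnorm : ∀ τ, 0 ≤ τ → Summable fun n : ℕ =>
      ∫ ρ in Ioi (0:ℝ), ‖(c n + d n * (τ + ρ)) * Real.exp (-(((n:ℝ) + 1) * (τ + ρ)))‖ := by
    intro τ hτ
    refine Summable.of_nonneg_of_le (fun n => integral_nonneg fun ρ => norm_nonneg _) (fun n => ?_)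
      (summable_three_half.mul_left (3 * C))
    have hN : (0:ℝ) < (n:ℝ) + 1 := by positivity
    calc _ ≤ ∫ ρ in Ioi (0:ℝ), (|c n| + |d n| * (τ + ρ)) * Real.exp (-(((n:ℝ) + 1) * (τ + ρ))) := by
          refine setIntegral_mono_on (expint_int _ _ τ _ hτ hN).norm (expint_int _ _ τ _ hτ hN)
            measurableSet_Ioi fun ρ hρ => ?_
          have hρ' : (0:ℝ) < ρ := hρ
          rw [norm_mul, Real.norm_eq_abs, Real.norm_eq_abs, abs_of_pos (Real.exp_pos _)]
          refine mul_le_mul_of_nonneg_right ((abs_add_le _ _).trans ?_) (Real.exp_pos _).le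
          rw [abs_mul, abs_of_nonneg (by positivity : 0 ≤ τ + ρ)]
      _ = (|c n| / ((n:ℝ) + 1) + |d n| / ((n:ℝ) + 1) ^ 2 + |d n| / ((n:ℝ) + 1) * τ)
            * Real.exp (-(((n:ℝ) + 1) * τ)) := expint_eq _ _ _ _ hτ hN
      _ ≤ |c n| / ((n:ℝ) + 1) + |d n| / ((n:ℝ) + 1) ^ 2 + |d n| / ((n:ℝ) + 1) ^ 2 := by
          rw [add_mul]
          refine add_le_add (mul_le_of_le_one_right (by positivity) ?_) ?_
          · rw [Real.exp_le_one_iff]; have := mul_nonneg hN.le hτ; linarith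
          · have hx : ((n:ℝ) + 1) * τ * Real.exp (-(((n:ℝ) + 1) * τ)) ≤ 1 := by
              rw [Real.exp_neg, ← div_eq_mul_inv, div_le_one (Real.exp_pos _)]
              linarith [Real.add_one_le_exp (((n:ℝ) + 1) * τ)]
            calc |d n| / ((n:ℝ) + 1) * τ * Real.exp (-(((n:ℝ) + 1) * τ))
                = |d n| / ((n:ℝ) + 1) ^ 2 * (((n:ℝ) + 1) * τ * Real.exp (-(((n:ℝ) + 1) * τ))) := by
                  field_simp
              _ ≤ _ := mul_le_of_le_one_right (by positivity) hx
      _ ≤ 3 * C * (1 / (((n:ℝ) + 1) * √((n:ℝ) + 1))) := by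
          have := hbound n; linarith [this.1, this.2]
  have hN : ∀ n : ℕ, (0:ℝ) < (n:ℝ) + 1 := fun n => by positivity
  refine ⟨fun τ hτ => ?_, ⟨2 * C, by positivity, fun n => ⟨?_, ?_⟩⟩, fun τ hτ => ?_⟩
  · have h1 : opR K τ ≤ ∫⁻ ρ in Ioi (0:ℝ), ∑' n : ℕ,
        ‖(c n + d n * (τ + ρ)) * Real.exp (-(((n:ℝ) + 1) * (τ + ρ)))‖ₑ := by
      unfold opR
      refine setLIntegral_mono' measurableSet_Ioi fun ρ hρ => ?_
      have hρ' : 0 < τ + ρ := by have : (0:ℝ) < ρ := hρ; linarith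
      have : _ = (K (τ + ρ)).toReal := (hs _ hρ').tsum_eq
      rw [← ENNReal.ofReal_toReal (hfin _ hρ'), ← this]
      refine le_trans ?_ enorm_tsum_le_tsum_enorm
      exact Real.ofReal_le_enorm _
    refine ne_top_of_le_ne_top ?_ h1
    rw [lintegral_tsum (fun n => by fun_prop)]
    have h2 : ∀ n : ℕ, ∫⁻ ρ in Ioi (0:ℝ),
        ‖(c n + d n * (τ + ρ)) * Real.exp (-(((n:ℝ) + 1) * (τ + ρ)))‖ₑ
        = ENNReal.ofReal (∫ ρ in Ioi (0:ℝ),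
          ‖(c n + d n * (τ + ρ)) * Real.exp (-(((n:ℝ) + 1) * (τ + ρ)))‖) := fun n =>
      (ofReal_integral_norm_eq_lintegral_enorm (expint_int _ _ τ _ hτ (hN n))).symm
    simp_rw [h2]
    exact (hnorm τ hτ).tsum_ofReal_ne_top
  · refine (abs_add_le _ _).trans ?_
    rw [abs_div, abs_div, abs_of_pos (hN n), abs_of_pos (pow_pos (hN n) 2), div_eq_mul_one_div (2 * C)]
    have := hbound n; linarith [this.1, this.2]
  · rw [abs_div, abs_of_pos (hN n), div_le_iff₀ (hN n)]
    have hu := one_le_sqrt_succ n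
    have hu2 : √((n:ℝ) + 1) * √((n:ℝ) + 1) = (n:ℝ) + 1 := Real.mul_self_sqrt (by positivity)
    refine (hb n).2.trans ?_
    rw [div_mul_eq_mul_div, le_div_iff₀ (by positivity), mul_assoc, hu2]
    have := mul_nonneg hC (hN n).le
    linarith
  · have h1 := hasSum_integral_of_summable_integral_norm
      (fun n : ℕ => expint_int (c n) (d n) τ _ hτ (hN n)) (hnorm τ hτ)
    have h2 : (opR K τ).toReal = ∫ ρ in Ioi (0:ℝ), ∑' n : ℕ,
        (c n + d n * (τ + ρ)) * Real.exp (-(((n:ℝ) + 1) * (τ + ρ))) := by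
      unfold opR
      rw [← integral_toReal (by fun_prop)]
      · refine setIntegral_congr_fun measurableSet_Ioi fun ρ hρ => ?_
        have hρ' : 0 < τ + ρ := by have : (0:ℝ) < ρ := hρ; linarith
        exact (hs _ hρ').tsum_eq.symm
      · filter_upwards [ae_restrict_mem measurableSet_Ioi] with ρ hρ
        have hρ' : 0 < τ + ρ := by have : (0:ℝ) < ρ := hρ; linarith
        exact (hfin _ hρ').lt_top
    simp only
    rw [h2]
    refine h1.congr_fun fun n => ?_
    rw [expint_eq _ _ τ _ hτ (hN n)]

/-! #### Division by `e^τ - 1` -/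

lemma summable_bdd_exp (X : ℕ → ℝ) (C τ : ℝ) (hτ : 0 < τ) (hX : ∀ n : ℕ, |X n| ≤ C * ((n:ℝ) + 1)) :
    Summable fun n : ℕ => X n * Real.exp (-(((n:ℝ) + 1) * τ)) := by
  have hr : ‖Real.exp (-τ)‖ < 1 := by
    rw [Real.norm_eq_abs, abs_of_pos (Real.exp_pos _), Real.exp_lt_one_iff]; linarith
  have h0 : Summable fun n : ℕ => (n:ℝ) ^ 1 * Real.exp (-τ) ^ n :=
    summable_pow_mul_geometric_of_norm_lt_one 1 hr
  have h1 : Summable fun n : ℕ => ((n:ℝ) + 1) * Real.exp (-τ) ^ (n + 1) := by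
    have := (summable_nat_add_iff 1).mpr h0
    refine this.congr fun n => ?_
    push_cast
    rw [pow_one]
  refine Summable.of_norm_bounded (h1.mul_left C) fun n => ?_
  rw [norm_mul, Real.norm_eq_abs, Real.norm_eq_abs, abs_of_pos (Real.exp_pos _)]
  have : Real.exp (-(((n:ℝ) + 1) * τ)) = Real.exp (-τ) ^ (n + 1) := by
    rw [← Real.exp_nat_mul]; congr 1; push_cast; ring
  rw [this, ← mul_assoc]
  exact mul_le_mul_of_nonneg_right (hX n) (by positivity)

lemma lemDiv {k k' : ℝ → ℝ} {c d : ℕ → ℝ} (h : InS k' c d)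
    (hk : ∀ τ, 0 < τ → (Real.exp τ - 1) * k τ = k' 0 - k' τ) :
    ∃ C D, InE k C D := by
  obtain ⟨⟨C, hC, hb⟩, hs⟩ := h
  have h0 : HasSum c (k' 0) := by simpa using hs 0 le_rfl
  have hN : ∀ n : ℕ, (0:ℝ) < (n:ℝ) + 1 := fun n => by positivity
  let X : ℕ → ℝ := fun N => k' 0 - ∑ m ∈ Finset.range N, c m
  let Y : ℕ → ℝ := fun N => - ∑ m ∈ Finset.range N, d m
  have hX : ∀ N : ℕ, |X N| ≤ 6 * C / √((N:ℝ) + 1) := by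
    intro N
    have ht : Tendsto (fun M => |∑ m ∈ Finset.range M, c (N + m)|) atTop (𝓝 |X N|) := by
      have h1 := (h0.tendsto_sum_nat.comp (tendsto_add_atTop_nat N)).sub_const
        (∑ m ∈ Finset.range N, c m)
      refine (h1.congr fun M => ?_).abs
      simp only [Function.comp]
      rw [add_comm M N, Finset.sum_range_add]; ring
    refine le_of_tendsto ht (Eventually.of_forall fun M => ?_)
    refine (Finset.abs_sum_le_sum_abs _ _).trans ?_
    calc _ ≤ ∑ m ∈ Finset.range M, C * (1 / (((N + m : ℕ) + 1 : ℝ) * √((N + m : ℕ) + 1 : ℝ))) :=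
          Finset.sum_le_sum fun m _ => by
            rw [mul_one_div]; exact (hb (N + m)).1
      _ ≤ C * (6 * (1 / √((N:ℝ) + 1))) := by
          rw [← Finset.mul_sum]
          refine mul_le_mul_of_nonneg_left ?_ hC
          have := sqrt_tail N M
          have h2 : 0 ≤ 6 * (1 / √((N + M : ℕ) + 1 : ℝ)) := by positivity
          linarith
      _ = _ := by ring
  have hY : ∀ N : ℕ, |Y N| ≤ 2 * C * √((N:ℝ) + 1) := by
    intro N
    simp only [Y, abs_neg]
    refine (Finset.abs_sum_le_sum_abs _ _).trans ?_
    calc _ ≤ ∑ m ∈ Finset.range N, C * (1 / √((m:ℝ) + 1)) :=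
          Finset.sum_le_sum fun m _ => by rw [mul_one_div]; exact (hb m).2
      _ ≤ C * (2 * √(N:ℝ)) := by
          rw [← Finset.mul_sum]
          exact mul_le_mul_of_nonneg_left (sqrt_partial N) hC
      _ ≤ C * (2 * √((N:ℝ) + 1)) := by
          have : √(N:ℝ) ≤ √((N:ℝ) + 1) := Real.sqrt_le_sqrt (by linarith)
          gcongr
      _ = _ := by ring
  refine ⟨X, Y, ⟨6 * C, by positivity, fun n => ⟨hX n, (hY n).trans ?_⟩⟩, fun τ hτ => ?_⟩
  · have := Real.sqrt_nonneg ((n:ℝ) + 1)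
    have := mul_nonneg hC this
    linarith
  · have hsum : Summable fun n : ℕ => (X n + Y n * τ) * Real.exp (-(((n:ℝ) + 1) * τ)) := by
      refine summable_bdd_exp _ (6 * C + 2 * C * τ) τ hτ fun n => ?_
      have hu := one_le_sqrt_succ n
      have hu2 : √((n:ℝ) + 1) * √((n:ℝ) + 1) = (n:ℝ) + 1 := Real.mul_self_sqrt (by positivity)
      have hun : √((n:ℝ) + 1) ≤ (n:ℝ) + 1 := by nlinarith
      have h1 : |X n| ≤ 6 * C * ((n:ℝ) + 1) := by
        refine (hX n).trans ?_
        rw [div_le_iff₀ (by positivity)]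
        have : 1 ≤ ((n:ℝ) + 1) * √((n:ℝ) + 1) := by nlinarith
        nlinarith
      have h2 : |Y n| ≤ 2 * C * ((n:ℝ) + 1) := (hY n).trans (by gcongr)
      refine (abs_add_le _ _).trans ?_
      rw [abs_mul, abs_of_pos hτ]
      nlinarith
    have hS := hsum.hasSum
    set S := ∑' n : ℕ, (X n + Y n * τ) * Real.exp (-(((n:ℝ) + 1) * τ)) with hSdef
    -- e^τ S
    have h1 : HasSum (fun n : ℕ => (X n + Y n * τ) * Real.exp (-((n:ℝ) * τ))) (Real.exp τ * S) := by
      refine (hS.mul_left (Real.exp τ)).congr_fun ?_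
      intro n
      rw [mul_left_comm, ← Real.exp_add]
      congr 2; ring
    have h2 := (hasSum_nat_add_iff' 1).mpr h1
    have h3 := h2.sub hS
    have h4 : HasSum (fun n : ℕ => (c n + d n * τ) * Real.exp (-(((n:ℝ) + 1) * τ)))
        (-(Real.exp τ * S - ∑ i ∈ Finset.range 1, (X i + Y i * τ) * Real.exp (-((i:ℝ) * τ)) - S)) := by
      refine h3.neg.congr_fun ?_
      intro n
      simp only [X, Y, Finset.sum_range_succ]
      push_cast
      ring
    have h5 := h4.unique (hs τ hτ.le)
    have h6 := hk τ hτ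
    simp [X, Y] at h5
    have h7 : (Real.exp τ - 1) * S = (Real.exp τ - 1) * k τ := by rw [h6]; linarith
    have h8 : Real.exp τ - 1 ≠ 0 := by
      have := Real.add_one_lt_exp hτ.ne'; intro h; linarith
    rw [← mul_left_cancel₀ h8 h7]
    exact hS


/-! ### Words -/

def fA : List Bool → ℝ → ℝ≥0∞
  | [] => sE
  | true :: l => fun α => sE α * opL (fA l) α
  | false :: l => opL (fA l)

def gB : List Bool → ℝ → ℝ≥0∞
  | [] => xE
  | true :: l => fun α => xE α * opR (gB l) α
  | false :: l => opR (gB l)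

lemma meas_fA : ∀ l, Measurable (fA l)
  | [] => meas_sE
  | true :: l => meas_sE.mul (meas_opL (meas_fA l))
  | false :: l => meas_opL (meas_fA l)

lemma meas_gB : ∀ l, Measurable (gB l)
  | [] => meas_xE
  | true :: l => meas_xE.mul (meas_opR (meas_gB l))
  | false :: l => meas_opR (meas_gB l)

def Good (K : ℝ → ℝ≥0∞) : Prop :=
  (∀ τ, 0 < τ → K τ ≠ ⊤) ∧ ∃ c d, InE (fun τ => (K τ).toReal) c d

def GoodS (K : ℝ → ℝ≥0∞) : Prop :=
  (∀ τ, 0 ≤ τ → K τ ≠ ⊤) ∧ ∃ c d, InS (fun τ => (K τ).toReal) c d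

lemma GoodS.good {K} (h : GoodS K) : Good K := by
  obtain ⟨h1, c, d, h2⟩ := h
  exact ⟨fun τ hτ => h1 τ hτ.le, c, d, h2.toInE⟩

lemma Good.goodS {K} (hK : Measurable K) (h : Good K) : GoodS (opR K) := by
  obtain ⟨h1, c, d, h2⟩ := h
  have := lemD hK h1 h2
  exact ⟨this.1, _, _, this.2⟩

lemma ofReal_exp_sub_ne {τ : ℝ} (hτ : 0 < τ) : ENNReal.ofReal (Real.exp τ - 1) ≠ 0 := by
  have := Real.add_one_lt_exp hτ.ne'
  rw [Ne, ENNReal.ofReal_eq_zero, not_le]; linarith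

lemma toReal_ofReal_exp {τ : ℝ} (hτ : 0 < τ) :
    (ENNReal.ofReal (Real.exp τ - 1)).toReal = Real.exp τ - 1 := by
  have := Real.add_one_lt_exp hτ.ne'
  rw [ENNReal.toReal_ofReal]; linarith

lemma good_of_rel {K K' : ℝ → ℝ≥0∞} (h : GoodS K')
    (hr : ∀ τ, 0 ≤ τ → ENNReal.ofReal (Real.exp τ - 1) * K τ + K' τ = K' 0) : Good K := by
  obtain ⟨h1, c, d, h2⟩ := h
  have hfin : ∀ τ, 0 < τ → ENNReal.ofReal (Real.exp τ - 1) * K τ ≠ ⊤ := fun τ hτ =>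
    ne_top_of_le_ne_top (h1 0 le_rfl) (by rw [← hr τ hτ.le]; exact le_self_add)
  refine ⟨fun τ hτ htop => hfin τ hτ ?_, lemDiv h2 fun τ hτ => ?_⟩
  · rw [htop, ENNReal.mul_top (ofReal_exp_sub_ne hτ)]
  · rw [← hr τ hτ.le, ENNReal.toReal_add (hfin τ hτ) (h1 τ hτ.le), ENNReal.toReal_mul,
      toReal_ofReal_exp hτ]
    ring

lemma good_of_rel3 {K K1 K2 K3 : ℝ → ℝ≥0∞} (h1 : GoodS K1) (h2 : GoodS K2) (h3 : GoodS K3)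
    (hr : ∀ τ, 0 ≤ τ → ENNReal.ofReal (Real.exp τ - 1) * K τ + K1 τ + K2 τ = K3 τ) : Good K := by
  obtain ⟨f1, c1, d1, e1⟩ := h1
  obtain ⟨f2, c2, d2, e2⟩ := h2
  obtain ⟨f3, c3, d3, e3⟩ := h3
  have hfin : ∀ τ, 0 < τ → ENNReal.ofReal (Real.exp τ - 1) * K τ ≠ ⊤ := fun τ hτ =>
    ne_top_of_le_ne_top (f3 τ hτ.le) (by rw [← hr τ hτ.le, add_assoc]; exact le_self_add)
  refine ⟨fun τ hτ htop => hfin τ hτ ?_, lemDiv ((e1.add e2).add e3.neg) fun τ hτ => ?_⟩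
  · rw [htop, ENNReal.mul_top (ofReal_exp_sub_ne hτ)]
  · have h0 := hr 0 le_rfl
    simp only [Real.exp_zero, sub_self, ENNReal.ofReal_zero, zero_mul, zero_add] at h0
    rw [← h0, ← hr τ hτ.le, ENNReal.toReal_add (ENNReal.add_ne_top.mpr ⟨hfin τ hτ, f1 τ hτ.le⟩)
      (f2 τ hτ.le), ENNReal.toReal_add (hfin τ hτ) (f1 τ hτ.le), ENNReal.toReal_mul,
      toReal_ofReal_exp hτ, ENNReal.toReal_add (f1 0 le_rfl) (f2 0 le_rfl)]
    ring

lemma good_base : Good (opK sE xE) := by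
  have hne : ∀ τ, 0 < τ → opK sE xE τ ≠ ⊤ := fun τ hτ htop => by
    have := rel_base τ hτ.le
    rw [htop, ENNReal.mul_top (ofReal_exp_sub_ne hτ)] at this
    exact ENNReal.ofReal_ne_top this.symm
  refine ⟨hne, fun _ => 0, fun _ => 1, ⟨1, zero_le_one, fun n => ⟨?_, ?_⟩⟩, fun τ hτ => ?_⟩
  · simp
  · simp
  · have h1 : (Real.exp τ - 1) * (opK sE xE τ).toReal = τ := by
      have := congrArg ENNReal.toReal (rel_base τ hτ.le)
      rwa [ENNReal.toReal_mul, toReal_ofReal_exp hτ, ENNReal.toReal_ofReal hτ.le] at this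
    have hlt : Real.exp (-τ) < 1 := by rw [Real.exp_lt_one_iff]; linarith
    have h2 := (hasSum_geometric_of_lt_one (Real.exp_pos (-τ)).le hlt).mul_left
      (τ * Real.exp (-τ))
    have h3 : τ * Real.exp (-τ) * (1 - Real.exp (-τ))⁻¹ = (opK sE xE τ).toReal := by
      have h4 : 1 - Real.exp (-τ) ≠ 0 := by linarith
      rw [← div_eq_mul_inv, div_eq_iff h4]
      nth_rewrite 1 [← h1]
      have : Real.exp τ * Real.exp (-τ) = 1 := by rw [← Real.exp_add]; simp
      linear_combination (opK sE xE τ).toReal * this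
    rw [h3] at h2
    refine h2.congr_fun fun n => ?_
    have : Real.exp (-(((n:ℝ) + 1) * τ)) = Real.exp (-τ) ^ (n + 1) := by
      rw [← Real.exp_nat_mul]; congr 1; push_cast; ring
    rw [this]; ring

lemma good_words : ∀ (N : ℕ) (l m : List Bool), l.length + m.length ≤ N →
    Good (opK (fA l) (gB m)) := by
  intro N
  induction N with
  | zero =>
    intro l m h
    have hl : l = [] := List.length_eq_zero_iff.mp (by omega)
    have hm : m = [] := List.length_eq_zero_iff.mp (by omega)
    subst hl hm
    exact good_base
  | succ N ih =>
    intro l m h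
    match l, m with
    | false :: l, m =>
      have h0 : Good (opK (fA l) (gB m)) := ih l m (by simp at h; omega)
      show Good (opK (opL (fA l)) (gB m))
      rw [opK_L (meas_fA l) (meas_gB m)]
      exact (h0.goodS (meas_opK (meas_fA l) (meas_gB m))).good
    | l, false :: m =>
      have h0 : Good (opK (fA l) (gB m)) := ih l m (by simp at h; omega)
      show Good (opK (fA l) (opR (gB m)))
      rw [opK_R (meas_fA l) (meas_gB m)]
      exact (h0.goodS (meas_opK (meas_fA l) (meas_gB m))).good
    | [], [] => exact good_base
    | [], true :: m =>
      have h0 : Good (opK (fA []) (gB m)) := ih [] m (by simp at h ⊢; omega)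
      have h1 := h0.goodS (meas_opK (meas_fA []) (meas_gB m))
      rw [← opK_R (meas_fA []) (meas_gB m)] at h1
      exact good_of_rel h1 fun τ hτ => rel_left (meas_opR (meas_gB m)) τ hτ
    | true :: l, [] =>
      have h0 : Good (opK (fA l) (gB [])) := ih l [] (by simp at h ⊢; omega)
      have h1 := h0.goodS (meas_opK (meas_fA l) (meas_gB []))
      rw [← opK_L (meas_fA l) (meas_gB [])] at h1
      exact good_of_rel h1 fun τ hτ => rel_right (meas_opL (meas_fA l)) τ hτ
    | true :: l, true :: m =>
      have a1 : Good (opK (fA (true :: l)) (gB m)) := ih (true :: l) m (by simp at h ⊢; omega)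
      have a2 : Good (opK (fA l) (gB (true :: m))) := ih l (true :: m) (by simp at h ⊢; omega)
      have a3 : Good (opK (fA l) (gB m)) := ih l m (by simp at h ⊢; omega)
      have b1 := a1.goodS (meas_opK (meas_fA _) (meas_gB _))
      rw [← opK_R (meas_fA _) (meas_gB _)] at b1
      have b2 := a2.goodS (meas_opK (meas_fA _) (meas_gB _))
      rw [← opK_L (meas_fA _) (meas_gB _)] at b2
      have b3 := a3.goodS (meas_opK (meas_fA _) (meas_gB _))
      rw [← opK_R (meas_fA _) (meas_gB _)] at b3
      have b4 := b3.good.goodS (meas_opK (meas_fA _) (meas_opR (meas_gB _)))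
      rw [← opK_L (meas_fA _) (meas_opR (meas_gB _))] at b4
      exact good_of_rel3 b1 b2 b4 fun τ hτ =>
        rel_gen (meas_opL (meas_fA l)) (meas_opR (meas_gB m)) τ hτ

/-- iterating `L` on the left. -/
lemma iter_coeff {f g : ℝ → ℝ≥0∞} (hf : Measurable f) (hg : Measurable g)
    (hfin : ∀ τ, 0 < τ → opK f g τ ≠ ⊤) {c d : ℕ → ℝ}
    (h : InE (fun τ => (opK f g τ).toReal) c d) (s : ℕ) :
    Measurable (opL^[s + 1] f) ∧ (∀ τ, 0 ≤ τ → opK (opL^[s + 1] f) g τ ≠ ⊤) ∧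
    InS (fun τ => (opK (opL^[s + 1] f) g τ).toReal)
      (fun n => c n / ((n:ℝ) + 1) ^ (s + 1) + (s + 1) * d n / ((n:ℝ) + 1) ^ (s + 2))
      (fun n => d n / ((n:ℝ) + 1) ^ (s + 1)) := by
  induction s with
  | zero =>
    have := lemD (meas_opK hf hg) hfin h
    rw [← opK_L hf hg] at this
    simpa using ⟨meas_opL hf, this⟩
  | succ s ih =>
    obtain ⟨i1, i2, i3⟩ := ih
    have := lemD (meas_opK i1 hg) (fun τ hτ => i2 τ hτ.le) i3.toInE
    rw [← opK_L i1 hg] at this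
    rw [Function.iterate_succ_apply']
    refine ⟨meas_opL i1, this.1, ?_⟩
    convert this.2 using 1
    · funext n
      have : (n:ℝ) + 1 ≠ 0 := by positivity
      push_cast
      field_simp
      ring
    · funext n
      have : (n:ℝ) + 1 ≠ 0 := by positivity
      field_simp
      ring

/-! ### Multiple zeta values as iterated integrals -/

def wE (j n : ℕ) : ℝ≥0∞ := ((n : ℝ≥0∞) + 1)⁻¹ ^ j

/-- drop the last entry -/
def restr {r : ℕ} (k : Fin (r + 1) → ℕ) : Fin r → ℕ := fun i => k i.castSucc

lemma restr_snoc {r : ℕ} (k : Fin r → ℕ) (a : ℕ) :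
    restr (Fin.snoc k a : Fin (r + 1) → ℕ) = k := by
  funext i
  simp [restr]

def UU : (r : ℕ) → (Fin r → ℕ) → ℕ → ℝ≥0∞
  | 0, _, _ => 1
  | r + 1, k, N => ∑ m ∈ Finset.range N, wE (k (Fin.last r)) m * UU r (restr k) m

lemma strictMono_snoc {r : ℕ} (n : Fin r → ℕ) (m : ℕ) :
    StrictMono (Fin.snoc n m : Fin (r + 1) → ℕ) ↔ StrictMono n ∧ ∀ i, n i < m := by
  constructor
  · intro h
    refine ⟨fun i j hij => ?_, fun i => ?_⟩
    · have := h (Fin.castSucc_lt_castSucc_iff.mpr hij)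
      simpa using this
    · have := h (Fin.castSucc_lt_last i)
      simpa using this
  · rintro ⟨h1, h2⟩ i j hij
    induction j using Fin.lastCases with
    | last =>
      induction i using Fin.lastCases with
      | last => exact absurd hij (lt_irrefl _)
      | cast i => simpa using h2 i
    | cast j =>
      induction i using Fin.lastCases with
      | last => exact absurd hij (not_lt.mpr (Fin.le_last _))
      | cast i =>
        have := h1 (Fin.castSucc_lt_castSucc_iff.mp hij)
        simpa using this

lemma tsum_snoc {r : ℕ} (F : (Fin (r + 1) → ℕ) → ℝ≥0∞) :
    ∑' n, F n = ∑' m : ℕ, ∑' n : Fin r → ℕ, F (Fin.snoc n m) := by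
  rw [← (Fin.snocEquiv (fun _ : Fin (r + 1) => ℕ)).tsum_eq, ENNReal.tsum_prod']
  rfl

open Classical in
lemma UU_eq (r : ℕ) (k : Fin r → ℕ) (N : ℕ) :
    UU r k N = ∑' n : Fin r → ℕ,
      if StrictMono n ∧ ∀ i, n i < N then ∏ i, wE (k i) (n i) else 0 := by
  induction r generalizing N with
  | zero =>
    rw [tsum_eq_single (fun i => i.elim0) (fun b hb => absurd (Subsingleton.elim _ _) hb)]
    simp [UU, Subsingleton.strictMono]
  | succ r ih =>
    rw [tsum_snoc, UU]
    rw [tsum_eq_sum (s := Finset.range N)]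
    · refine Finset.sum_congr rfl fun m hm => ?_
      rw [ih, ← ENNReal.tsum_mul_left]
      refine tsum_congr fun n => ?_
      have hm' : m < N := Finset.mem_range.mp hm
      by_cases h : StrictMono n ∧ ∀ i, n i < m
      · have h2 : ∀ i, (Fin.snoc n m : Fin (r + 1) → ℕ) i < N := by
          rw [Fin.forall_fin_succ']
          simpa [hm'] using fun i => (h.2 i).trans hm'
        rw [if_pos h, if_pos ⟨(strictMono_snoc n m).mpr h, h2⟩, Fin.prod_univ_castSucc]
        simp [restr, mul_comm]
      · rw [if_neg h, if_neg fun h' => h ((strictMono_snoc n m).mp h'.1), mul_zero]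
    · intro m hm
      rw [Finset.mem_range] at hm
      refine ENNReal.tsum_eq_zero.mpr fun n => if_neg fun h => hm ?_
      simpa using h.2 (Fin.last r)

def VV (r : ℕ) (k : Fin (r + 1) → ℕ) : ℝ≥0∞ :=
  ∑' n, wE (k (Fin.last r)) n * UU r (restr k) n

open Classical in
lemma VV_eq (r : ℕ) (k : Fin (r + 1) → ℕ) :
    VV r k = ∑' n : {n : Fin (r + 1) → ℕ // StrictMono n}, ∏ i, wE (k i) (n.1 i) := by
  have h := tsum_subtype (f := fun n : Fin (r + 1) → ℕ => ∏ i, wE (k i) (n i)) {n | StrictMono n}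
  refine Eq.trans ?_ h.symm
  rw [tsum_snoc, VV]
  refine tsum_congr fun m => ?_
  rw [UU_eq, ← ENNReal.tsum_mul_left]
  refine tsum_congr fun n => ?_
  by_cases h : StrictMono n ∧ ∀ i, n i < m
  · rw [if_pos h, indicator_of_mem (show _ ∈ {n | StrictMono n} from (strictMono_snoc n m).mpr h),
      Fin.prod_univ_castSucc]
    simp [restr, mul_comm]
  · rw [if_neg h, indicator_of_notMem
      (show _ ∉ {n | StrictMono n} from fun h' => h ((strictMono_snoc n m).mp h')), mul_zero]

def shiftEquiv (r : ℕ) : {n : Fin r → ℕ // StrictMono n} ≃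
    {n : Fin r → ℕ // (∀ i, 0 < n i) ∧ StrictMono n} where
  toFun n := ⟨fun i => n.1 i + 1, fun i => Nat.succ_pos _, fun i j h => by
    have := n.2 h
    simpa using this⟩
  invFun n := ⟨fun i => n.1 i - 1, fun i j h => by
    have := n.2.2 h
    have := n.2.1 i
    show n.1 i - 1 < n.1 j - 1
    omega⟩
  left_inv n := by ext; simp
  right_inv n := by
    ext i
    have := n.2.1 i
    show n.1 i - 1 + 1 = n.1 i
    omega

lemma wE_ne_top (j n : ℕ) : wE j n ≠ ⊤ := by
  unfold wE
  refine ENNReal.pow_ne_top ?_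
  simp

lemma wE_toReal (j n : ℕ) : (wE j n).toReal = 1 / ((n : ℝ) + 1) ^ j := by
  unfold wE
  rw [ENNReal.toReal_pow, ENNReal.toReal_inv, ENNReal.toReal_add (by simp) (by simp)]
  simp

lemma MZV_eq (r : ℕ) (k : Fin (r + 1) → ℕ) : MZV (r + 1) k = (VV r k).toReal := by
  rw [VV_eq, ENNReal.tsum_toReal_eq (fun n => ENNReal.prod_ne_top fun i _ => wE_ne_top _ _), MZV,
    ← (shiftEquiv (r + 1)).tsum_eq]
  refine tsum_congr fun n => ?_
  rw [ENNReal.toReal_prod]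
  refine Finset.prod_congr rfl fun i _ => ?_
  rw [wE_toReal]
  simp [shiftEquiv]

lemma sE_geom (α : ℝ) : sE α = ∑' j : ℕ, xE α * sE α ^ (j + 1) := by
  have hx0 : xE α ≠ 0 := by
    unfold xE
    rw [Ne, ENNReal.ofReal_eq_zero, not_le]
    linarith [Real.sigmoid_lt_one α]
  have hxt : xE α ≠ ⊤ := ENNReal.ofReal_ne_top
  have hs : (1 - sE α) = xE α := by
    rw [← sE_add_xE α]
    exact ENNReal.add_sub_cancel_left ENNReal.ofReal_ne_top
  simp_rw [pow_succ]
  rw [ENNReal.tsum_mul_left, ENNReal.tsum_mul_right, ENNReal.tsum_geometric, hs, ← mul_assoc,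
    ENNReal.mul_inv_cancel hx0 hxt, one_mul]

lemma ofReal_div_eq (n : ℕ) (α : ℝ) :
    ENNReal.ofReal (Real.sigmoid α ^ (n + 1) / (n + 1)) = wE 1 n * sE α ^ (n + 1) := by
  unfold wE sE
  rw [ENNReal.ofReal_div_of_pos (by positivity), ENNReal.ofReal_pow (Real.sigmoid_nonneg α),
    div_eq_mul_inv, mul_comm, pow_one, ENNReal.ofReal_add (by positivity) zero_le_one]
  simp

lemma opL_series (c : ℕ → ℝ≥0∞) (α : ℝ) :
    opL (fun α => ∑' n, c n * (xE α * sE α ^ (n + 1))) α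
      = ∑' n, c n * wE 1 n * sE α ^ (n + 1) := by
  have m1 := meas_sE
  have m2 := meas_xE
  unfold opL
  rw [lintegral_tsum (fun n => by fun_prop)]
  refine tsum_congr fun n => ?_
  rw [lintegral_const_mul _ (by fun_prop), mul_assoc, ← ofReal_div_eq, ← opL_pow]
  rfl

lemma lint_series (c : ℕ → ℝ≥0∞) :
    ∫⁻ α, (∑' n, c n * (xE α * sE α ^ (n + 1))) = ∑' n, c n * wE 1 n := by
  have m1 := meas_sE
  have m2 := meas_xE
  rw [lintegral_tsum (fun n => by fun_prop)]
  refine tsum_congr fun n => ?_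
  rw [lintegral_const_mul _ (by fun_prop), lintegral_pow]
  congr 1
  unfold wE
  rw [ENNReal.ofReal_div_of_pos (by positivity), div_eq_mul_inv, pow_one,
    ENNReal.ofReal_add (by positivity) zero_le_one]
  simp

lemma tsum_shift (f : ℕ → ℝ≥0∞) (n : ℕ) :
    ∑' N, (if n < N then f N else 0) = ∑' j, f (j + (n + 1)) := by
  rw [← ENNReal.summable.sum_add_tsum_nat_add' (k := n + 1)]
  rw [Finset.sum_eq_zero, zero_add]
  · refine tsum_congr fun j => if_pos (by omega)
  · intro i hi
    rw [Finset.mem_range] at hi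
    exact if_neg (by omega)

lemma mul_series (c : ℕ → ℝ≥0∞) (α : ℝ) :
    sE α * ∑' n, c n * sE α ^ (n + 1)
      = ∑' N, (∑ n ∈ Finset.range N, c n) * (xE α * sE α ^ (N + 1)) := by
  have h1 : ∀ N, (∑ n ∈ Finset.range N, c n) * (xE α * sE α ^ (N + 1))
      = ∑' n, if n < N then c n * (xE α * sE α ^ (N + 1)) else 0 := by
    intro N
    rw [Finset.sum_mul, tsum_eq_sum (s := Finset.range N)]
    · exact Finset.sum_congr rfl fun n hn => by rw [if_pos (Finset.mem_range.mp hn)]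
    · intro n hn
      rw [Finset.mem_range] at hn
      exact if_neg hn
  simp_rw [h1]
  rw [ENNReal.tsum_comm, ← ENNReal.tsum_mul_left]
  refine tsum_congr fun n => ?_
  rw [tsum_shift (fun N => c n * (xE α * sE α ^ (N + 1)))]
  nth_rewrite 1 [sE_geom α]
  rw [← ENNReal.tsum_mul_right]
  refine tsum_congr fun j => ?_
  ring

/-! ### Words and the zeta map -/

inductive Ltr where
  | x : Ltr
  | y : Ltr
  | z : Ltr

def wt : Ltr → ℝ → ℝ≥0∞
  | .x => xE
  | .y => sE
  | .z => fun _ => 1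

def hl : Ltr → H
  | .x => Hx
  | .y => Hy
  | .z => Hx + Hy

def FF : List Ltr → ℝ → ℝ≥0∞
  | [] => opL sE
  | a :: l => opL (fun α => wt a α * FF l α)

def hw : List Ltr → H
  | [] => 1
  | a :: l => hw l * hl a

def II (l : List Ltr) : ℝ≥0∞ := ∫⁻ α, FF l α * xE α

def bl : Bool → Ltr
  | true => .y
  | false => .x

lemma meas_wt : ∀ a, Measurable (wt a)
  | .x => meas_xE
  | .y => meas_sE
  | .z => measurable_const

lemma meas_FF : ∀ l, Measurable (FF l)
  | [] => meas_opL meas_sE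
  | a :: l => meas_opL ((meas_wt a).mul (meas_FF l))

lemma hw_append (m l : List Ltr) : hw (m ++ l) = hw l * hw m := by
  induction m with
  | nil => simp [hw]
  | cons a m ih => simp [hw, ih, mul_assoc]

lemma wE_add (i j n : ℕ) : wE (i + j) n = wE i n * wE j n := pow_add _ _ _

/-- coefficient sequence -/
def cf (r : ℕ) (k : Fin (r + 1) → ℕ) (n : ℕ) : ℝ≥0∞ :=
  wE (k (Fin.last r)) n * UU r (restr k) n

lemma FF_series (l : List Bool) : ∃ (r : ℕ) (k : Fin (r + 1) → ℕ), (∀ i, 1 ≤ k i) ∧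
    Hy * hw (l.map bl) = (List.ofFn fun i => Hy * Hx ^ (k i - 1)).prod ∧
    ∀ α, FF (l.map bl) α = ∑' n, cf r k n * sE α ^ (n + 1) := by
  induction l with
  | nil =>
    refine ⟨0, fun _ => 1, fun _ => le_rfl, by simp [hw], fun α => ?_⟩
    have h : opL sE α = opL (fun α => ∑' n, (fun _ => 1) n * (xE α * sE α ^ (n + 1))) α := by
      congr 1
      funext β
      simpa using sE_geom β
    simp only [List.map_nil, FF]
    rw [h, opL_series]
    simp [cf, UU]
  | cons a l ih =>
    obtain ⟨r, k, hk, hp, hs⟩ := ih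
    have hp2 : Hy * hw (l.map bl) = (List.ofFn fun i : Fin r => Hy * Hx ^ (k i.castSucc - 1)).prod
        * (Hy * Hx ^ (k (Fin.last r) - 1)) := by
      rw [hp, List.ofFn_succ']
      simp [List.concat_eq_append]
    cases a with
    | false =>
      refine ⟨r, Fin.snoc (restr k) (k (Fin.last r) + 1), ?_, ?_, fun α => ?_⟩
      · rw [Fin.forall_fin_succ']
        simpa [restr] using fun i => hk _
      · have h1 : k (Fin.last r) = k (Fin.last r) - 1 + 1 := by
          have := hk (Fin.last r)
          omega
        rw [List.ofFn_succ']
        simp only [List.map_cons, hw, bl, hl, List.concat_eq_append, List.prod_append,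
          Fin.snoc_castSucc, Fin.snoc_last, List.prod_cons, List.prod_nil, mul_one,
          add_tsub_cancel_right]
        rw [← mul_assoc, hp2, h1, pow_succ]
        simp [restr, mul_assoc]
      · have h : (fun α => xE α * FF (l.map bl) α)
            = fun α => ∑' n, cf r k n * (xE α * sE α ^ (n + 1)) := by
          funext β
          rw [hs, ← ENNReal.tsum_mul_left]
          exact tsum_congr fun n => by ring
        simp only [List.map_cons, FF, bl, wt]
        rw [h, opL_series]
        refine tsum_congr fun n => ?_
        simp only [cf, Fin.snoc_last, restr_snoc, wE_add]
        ring
    | true =>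
      refine ⟨r + 1, Fin.snoc k 1, ?_, ?_, fun α => ?_⟩
      · rw [Fin.forall_fin_succ']
        simpa using hk
      · rw [List.ofFn_succ']
        simp only [List.map_cons, hw, bl, hl, List.concat_eq_append, List.prod_append,
          Fin.snoc_castSucc, Fin.snoc_last, List.prod_cons, List.prod_nil, mul_one, tsub_self,
          pow_zero]
        rw [← mul_assoc, hp]
      · have h : (fun α => sE α * FF (l.map bl) α)
            = fun α => ∑' N, (∑ n ∈ Finset.range N, cf r k n) * (xE α * sE α ^ (N + 1)) := by
          funext β
          rw [hs, mul_series]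
        simp only [List.map_cons, FF, bl, wt]
        rw [h, opL_series]
        refine tsum_congr fun n => ?_
        simp only [cf, Fin.snoc_last, restr_snoc, UU]
        ring

lemma Z_xy {Z : H →ₗ[ℚ] ℝ} (hZ : IsZetaMap Z) (l : List Bool) :
    Z (Hy * hw (l.map bl) * Hx) = (II (l.map bl)).toReal := by
  obtain ⟨r, k, hk, hp, hs⟩ := FF_series l
  have hp2 : Hy * hw (l.map bl) = (List.ofFn fun i : Fin r => Hy * Hx ^ (k i.castSucc - 1)).prod
      * (Hy * Hx ^ (k (Fin.last r) - 1)) := by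
    rw [hp, List.ofFn_succ']
    simp [List.concat_eq_append]
  have h := hZ r (Fin.snoc (restr k) (k (Fin.last r) + 1)) (by
    rw [Fin.forall_fin_succ']
    simpa [restr] using fun i => hk _) (by simpa using hk _)
  rw [MZV_eq] at h
  have h1 : k (Fin.last r) = k (Fin.last r) - 1 + 1 := by
    have := hk (Fin.last r)
    omega
  have e1 : (List.ofFn fun i => Hy * Hx ^
      ((Fin.snoc (restr k) (k (Fin.last r) + 1) : Fin (r + 1) → ℕ) i - 1)).prod
      = Hy * hw (l.map bl) * Hx := by
    rw [List.ofFn_succ']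
    simp only [List.concat_eq_append, List.prod_append,
      Fin.snoc_castSucc, Fin.snoc_last, List.prod_cons, List.prod_nil, mul_one,
      add_tsub_cancel_right]
    rw [hp2, h1, pow_succ]
    simp [restr, mul_assoc]
  rw [e1] at h
  rw [h]
  congr 1
  have e2 : (fun α => FF (l.map bl) α * xE α)
      = fun α => ∑' n, cf r k n * (xE α * sE α ^ (n + 1)) := by
    funext β
    rw [hs, ← ENNReal.tsum_mul_right]
    exact tsum_congr fun n => by ring
  rw [II, e2, lint_series, VV]
  refine tsum_congr fun n => ?_
  simp only [cf, Fin.snoc_last, restr_snoc, wE_add]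
  ring

lemma opL_mono {f g : ℝ → ℝ≥0∞} (h : ∀ α, f α ≤ g α) (α : ℝ) : opL f α ≤ opL g α :=
  lintegral_mono fun _ => h _

lemma opL_add {f g : ℝ → ℝ≥0∞} (hf : Measurable f) :
    opL (fun α => f α + g α) = fun α => opL f α + opL g α := by
  funext α
  unfold opL
  exact lintegral_add_left (by fun_prop) _

lemma wt_le (a : Ltr) (α : ℝ) : wt a α ≤ 1 := by
  cases a with
  | x => exact (le_add_self).trans (sE_add_xE α).le
  | y => exact (le_self_add).trans (sE_add_xE α).le
  | z => exact le_rfl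

lemma FF_le (l : List Ltr) (α : ℝ) : FF l α ≤ opL^[l.length + 1] sE α := by
  induction l generalizing α with
  | nil => exact le_rfl
  | cons a l ih =>
    rw [List.length_cons, Function.iterate_succ_apply']
    refine opL_mono (fun β => ?_) α
    calc wt a β * FF l β ≤ 1 * FF l β := by gcongr; exact wt_le a β
      _ ≤ _ := by rw [one_mul]; exact ih β

lemma II_ne_top (l : List Ltr) : II l ≠ ⊤ := by
  obtain ⟨hfin, c, d, h⟩ := good_words 0 [] [] (by simp)
  have := (iter_coeff (meas_fA []) (meas_gB []) hfin h l.length).2.1 0 le_rfl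
  refine ne_top_of_le_ne_top this ?_
  unfold II opK
  refine lintegral_mono fun α => ?_
  rw [add_zero]
  exact mul_le_mul_left (FF_le l α) _

lemma FF_z (m l : List Ltr) (α : ℝ) :
    FF (m ++ .z :: l) α = FF (m ++ .x :: l) α + FF (m ++ .y :: l) α := by
  induction m generalizing α with
  | nil =>
    simp only [List.nil_append, FF, wt]
    rw [← congrFun (opL_add (f := fun β => xE β * FF l β) (meas_xE.mul (meas_FF l))) α]
    congr 1
    funext β
    rw [← add_mul, add_comm, sE_add_xE]
  | cons a m ih =>
    simp only [List.cons_append, FF]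
    rw [← congrFun (opL_add (f := fun β => wt a β * FF (m ++ .x :: l) β)
      ((meas_wt a).mul (meas_FF _))) α]
    congr 1
    funext β
    rw [ih, mul_add]

lemma II_z (m l : List Ltr) : II (m ++ .z :: l) = II (m ++ .x :: l) + II (m ++ .y :: l) := by
  unfold II
  rw [← lintegral_add_left (f := fun β => FF (m ++ .x :: l) β * xE β)
    ((meas_FF _).mul meas_xE)]
  refine lintegral_congr fun α => ?_
  rw [FF_z, add_mul]

lemma Z_xyz {Z : H →ₗ[ℚ] ℝ} (hZ : IsZetaMap Z) (m : List Ltr) : ∀ l : List Bool,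
    Z (Hy * hw (m.reverse ++ l.map bl) * Hx) = (II (m.reverse ++ l.map bl)).toReal := by
  induction m with
  | nil => exact fun l => Z_xy hZ l
  | cons a m ih =>
    intro l
    have hx := ih (false :: l)
    have hy := ih (true :: l)
    simp only [List.map_cons, bl] at hx hy
    rw [List.reverse_cons, List.append_assoc, List.singleton_append]
    cases a with
    | x => exact hx
    | y => exact hy
    | z =>
      rw [II_z, ENNReal.toReal_add (II_ne_top _) (II_ne_top _), ← hx, ← hy, ← map_add]
      congr 1
      simp only [hw_append, hw, hl]
      noncomm_ring

lemma Z_word {Z : H →ₗ[ℚ] ℝ} (hZ : IsZetaMap Z) (m : List Ltr) :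
    Z (Hy * hw m * Hx) = (II m).toReal := by
  have := Z_xyz hZ m.reverse []
  simpa using this

/-! ### Pairing -/

def yz : Bool → Ltr
  | true => .y
  | false => .z

def xz : Bool → Ltr
  | true => .x
  | false => .z

lemma FF_yz (l : List Bool) : FF (l.map yz) = opL (fA l) := by
  induction l with
  | nil => rfl
  | cons a l ih =>
    cases a with
    | true => simp only [List.map_cons, FF, yz, wt, ih, fA]
    | false => simp only [List.map_cons, FF, yz, wt, ih, fA, one_mul]

lemma FF_zs (s : ℕ) (l : List Ltr) : FF (List.replicate s .z ++ l) = opL^[s] (FF l) := by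
  induction s with
  | zero => rfl
  | succ s ih =>
    rw [Function.iterate_succ_apply', ← ih, List.replicate_succ, List.cons_append]
    simp only [FF, wt, one_mul]

lemma pair (m : List Bool) : ∀ l : List Ltr,
    II ((m.map xz).reverse ++ l) = opK (FF l) (gB m) 0 := by
  induction m with
  | nil =>
    intro l
    simp [II, opK, gB]
  | cons a m ih =>
    intro l
    rw [List.map_cons, List.reverse_cons, List.append_assoc, List.singleton_append, ih]
    cases a with
    | true =>
      simp only [FF, xz, wt, gB]
      have hm : Measurable fun α => xE α * FF l α := meas_xE.mul (meas_FF l)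
      rw [opK_L hm (meas_gB m), ← opK_R hm (meas_gB m)]
      unfold opK
      refine lintegral_congr fun α => ?_
      simp only [add_zero]
      ring
    | false =>
      simp only [FF, xz, wt, gB, one_mul]
      rw [opK_L (meas_FF l) (meas_gB m), ← opK_R (meas_FF l) (meas_gB m)]

lemma hw_zs (s : ℕ) : hw (List.replicate s .z) = (Hx + Hy) ^ s := by
  induction s with
  | zero => rfl
  | succ s ih => rw [List.replicate_succ, hw, ih, pow_succ, hl]

lemma Z_pair {Z : H →ₗ[ℚ] ℝ} (hZ : IsZetaMap Z) (l m : List Bool) (s : ℕ) :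
    Z (Hy * hw (l.map yz) * (Hx + Hy) ^ s * (hw (m.map xz).reverse * Hx))
      = (opK (opL^[s + 1] (fA l)) (gB m) 0).toReal := by
  have := Z_word hZ ((m.map xz).reverse ++ (List.replicate s .z ++ l.map yz))
  rw [pair, FF_zs, FF_yz, hw_append, hw_append, hw_zs] at this
  rw [Function.iterate_succ_apply, ← this]
  simp only [mul_assoc]

/-! ### Existence -/

def QQ (Z : H →ₗ[ℚ] ℝ) (A B : H) : Prop := ∃ ab : (ℕ → ℝ) × (ℕ → ℝ),
  ∀ s : ℕ, ∃ L1 L2 : ℝ, DSConv ab.1 s L1 ∧ DSConv ab.2 s L2 ∧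
    Z (A * (Hx + Hy) ^ s * B) = L1 + (s : ℝ) * L2

lemma DSConv.add {a b : ℕ → ℝ} {s : ℕ} {L M : ℝ} (h : DSConv a s L) (h2 : DSConv b s M) :
    DSConv (fun n => a n + b n) s (L + M) := by
  refine (Tendsto.add h h2).congr fun N => ?_
  rw [← Finset.sum_add_distrib]
  exact Finset.sum_congr rfl fun n _ => by ring

lemma DSConv.smul {a : ℕ → ℝ} {s : ℕ} {L : ℝ} (q : ℝ) (h : DSConv a s L) :
    DSConv (fun n => q * a n) s (q * L) := by
  refine (Tendsto.const_mul q h).congr fun N => ?_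
  rw [Finset.mul_sum]
  exact Finset.sum_congr rfl fun n _ => by ring

lemma QQ.comb {Z : H →ₗ[ℚ] ℝ} {A B A1 B1 A2 B2 : H} (h1 : QQ Z A1 B1) (h2 : QQ Z A2 B2) (q : ℚ)
    (h : ∀ w, A * w * B = A1 * w * B1 + q • (A2 * w * B2)) : QQ Z A B := by
  obtain ⟨⟨a1, b1⟩, h1⟩ := h1
  obtain ⟨⟨a2, b2⟩, h2⟩ := h2
  refine ⟨(fun n => a1 n + q * a2 n, fun n => b1 n + q * b2 n), fun s => ?_⟩
  obtain ⟨L1, M1, i1, j1, e1⟩ := h1 s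
  obtain ⟨L2, M2, i2, j2, e2⟩ := h2 s
  refine ⟨_, _, i1.add (i2.smul q), j1.add (j2.smul q), ?_⟩
  rw [h, map_add, map_smul, e1, e2, Rat.smul_def]
  ring

lemma QQ_word {Z : H →ₗ[ℚ] ℝ} (hZ : IsZetaMap Z) (l m : List Bool) :
    QQ Z (Hy * hw (l.map yz)) (hw (m.map xz).reverse * Hx) := by
  obtain ⟨hfin, c, d, h⟩ := good_words _ l m le_rfl
  obtain ⟨⟨C, hC0, hC⟩, -⟩ := id h
  have bd : ∀ n : ℕ, |d n / ((n:ℝ) + 1) ^ 2| ≤ C * (1 / (((n:ℝ) + 1) * √((n:ℝ) + 1))) := by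
    intro n
    have h1 : 0 < √((n:ℝ) + 1) := by positivity
    have h2 : √((n:ℝ) + 1) * √((n:ℝ) + 1) = (n:ℝ) + 1 := Real.mul_self_sqrt (by positivity)
    have h3 : (0:ℝ) < (n:ℝ) + 1 := by positivity
    rw [abs_div, abs_of_pos (by positivity : (0:ℝ) < ((n:ℝ) + 1) ^ 2)]
    calc |d n| / ((n:ℝ) + 1) ^ 2 ≤ C * √((n:ℝ) + 1) / ((n:ℝ) + 1) ^ 2 := by
          gcongr
          exact (hC n).2
      _ = C * (1 / (((n:ℝ) + 1) * √((n:ℝ) + 1))) := by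
          rw [mul_one_div, div_eq_div_iff (by positivity) (by positivity)]
          linear_combination C * ((n:ℝ) + 1) * h2
  have bc : ∀ n : ℕ, |c n / ((n:ℝ) + 1)| ≤ C * (1 / (((n:ℝ) + 1) * √((n:ℝ) + 1))) := by
    intro n
    have h1 : 0 < √((n:ℝ) + 1) := by positivity
    have h3 : (0:ℝ) < (n:ℝ) + 1 := by positivity
    rw [abs_div, abs_of_pos h3]
    calc |c n| / ((n:ℝ) + 1) ≤ C / √((n:ℝ) + 1) / ((n:ℝ) + 1) := by
          gcongr
          exact (hC n).1
      _ = C * (1 / (((n:ℝ) + 1) * √((n:ℝ) + 1))) := by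
          field_simp
  have sd : Summable fun n : ℕ => d n / ((n:ℝ) + 1) ^ 2 :=
    Summable.of_norm_bounded (summable_three_half.mul_left C) bd
  have sc : Summable fun n : ℕ => c n / ((n:ℝ) + 1) :=
    Summable.of_norm_bounded (summable_three_half.mul_left C) bc
  have key : ∀ (a : ℕ → ℝ), Summable a → ∀ s : ℕ, Summable fun n : ℕ => a n / ((n:ℝ) + 1) ^ s := by
    intro a ha s
    refine Summable.of_norm_bounded ha.norm fun n => ?_
    rw [norm_div]
    refine div_le_self (norm_nonneg _) ?_
    rw [Real.norm_of_nonneg (by positivity)]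
    exact one_le_pow₀ (by linarith [(Nat.cast_nonneg n : (0:ℝ) ≤ n)])
  refine ⟨(fun n => c n / ((n:ℝ) + 1) + d n / ((n:ℝ) + 1) ^ 2, fun n => d n / ((n:ℝ) + 1) ^ 2),
    fun s => ?_⟩
  have s1 := key _ (sc.add sd) s
  have s2 := key _ sd s
  refine ⟨_, _, s1.hasSum.tendsto_sum_nat, s2.hasSum.tendsto_sum_nat, ?_⟩
  rw [Z_pair hZ]
  have h4 := ((iter_coeff (meas_fA l) (meas_gB m) hfin h s).2.2.2 0 le_rfl)
  refine h4.unique ((s1.hasSum.add (s2.hasSum.mul_left (s:ℝ))).congr_fun fun n => ?_)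
  have h3 : (n:ℝ) + 1 ≠ 0 := by positivity
  simp only [mul_zero, add_zero, neg_zero, Real.exp_zero, mul_one]
  field_simp
  ring

lemma adjoin_top {u v : H} (hx : Hx ∈ Algebra.adjoin ℚ {u, v}) (hy : Hy ∈ Algebra.adjoin ℚ {u, v}) :
    Algebra.adjoin ℚ ({u, v} : Set H) = ⊤ := by
  rw [eq_top_iff, ← FreeAlgebra.adjoin_range_ι, Algebra.adjoin_le_iff]
  rintro _ ⟨b, rfl⟩
  cases b with
  | false => exact hx
  | true => exact hy

lemma span_top {u v : H} (hx : Hx ∈ Algebra.adjoin ℚ {u, v}) (hy : Hy ∈ Algebra.adjoin ℚ {u, v})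
    (w : H) : w ∈ Submodule.span ℚ (Submonoid.closure ({u, v} : Set H) : Set H) := by
  rw [← Algebra.adjoin_eq_span, adjoin_top hx hy]
  trivial

lemma span_yz (w : H) : w ∈ Submodule.span ℚ (range fun l : List Bool => hw (l.map yz)) := by
  have hv : Hx + Hy ∈ Algebra.adjoin ℚ {Hy, Hx + Hy} := Algebra.subset_adjoin (by simp)
  have hy : Hy ∈ Algebra.adjoin ℚ {Hy, Hx + Hy} := Algebra.subset_adjoin (by simp)
  have hx : Hx ∈ Algebra.adjoin ℚ {Hy, Hx + Hy} := by
    have := sub_mem hv hy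
    rwa [add_sub_cancel_right] at this
  refine Submodule.span_mono ?_ (span_top hx hy w)
  intro p hp
  refine Submonoid.closure_induction (motive := fun p _ => p ∈ range fun l : List Bool => hw (l.map yz))
    ?_ ?_ ?_ hp
  · rintro q (rfl | rfl)
    · exact ⟨[true], by simp [hw, yz, hl]⟩
    · exact ⟨[false], by simp [hw, yz, hl]⟩
  · exact ⟨[], rfl⟩
  · rintro p q - - ⟨l, rfl⟩ ⟨m, rfl⟩
    exact ⟨m ++ l, by simp [hw_append]⟩

lemma span_xz (w : H) :
    w ∈ Submodule.span ℚ (range fun l : List Bool => hw (l.map xz).reverse) := by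
  have hv : Hx + Hy ∈ Algebra.adjoin ℚ {Hx, Hx + Hy} := Algebra.subset_adjoin (by simp)
  have hx : Hx ∈ Algebra.adjoin ℚ {Hx, Hx + Hy} := Algebra.subset_adjoin (by simp)
  have hy : Hy ∈ Algebra.adjoin ℚ {Hx, Hx + Hy} := by
    have := sub_mem hv hx
    rwa [add_sub_cancel_left] at this
  refine Submodule.span_mono ?_ (span_top hx hy w)
  intro p hp
  refine Submonoid.closure_induction
    (motive := fun p _ => p ∈ range fun l : List Bool => hw (l.map xz).reverse)
    ?_ ?_ ?_ hp
  · rintro q (rfl | rfl)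
    · exact ⟨[true], by simp [hw, xz, hl]⟩
    · exact ⟨[false], by simp [hw, xz, hl]⟩
  · exact ⟨[], rfl⟩
  · rintro p q - - ⟨l, rfl⟩ ⟨m, rfl⟩
    exact ⟨l ++ m, by simp [hw_append]⟩

lemma QQ_zero {Z : H →ₗ[ℚ] ℝ} {A B : H} (h : ∀ w, A * w * B = 0) : QQ Z A B := by
  refine ⟨(fun _ => 0, fun _ => 0), fun s => ⟨0, 0, ?_, ?_, ?_⟩⟩
  · simp [DSConv]
  · simp [DSConv]
  · simp [h]

lemma QQ_all {Z : H →ₗ[ℚ] ℝ} (hZ : IsZetaMap Z) (v w : H) : QQ Z (Hy * v) (w * Hx) := by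
  induction span_xz w using Submodule.span_induction with
  | zero => exact QQ_zero fun w => by simp
  | add x y _ _ h1 h2 =>
    exact h1.comb h2 1 fun w => by rw [one_smul]; noncomm_ring
  | smul a x _ h1 =>
    exact (QQ_zero (A := 0) (B := 0) fun w => by simp).comb h1 a fun w => by simp [mul_assoc]
  | mem x hx =>
    obtain ⟨m, rfl⟩ := hx
    induction span_yz v using Submodule.span_induction with
    | zero => exact QQ_zero fun w => by simp
    | add x y _ _ h1 h2 =>
      exact h1.comb h2 1 fun w => by rw [one_smul]; noncomm_ring
    | smul a x _ h1 =>
      exact (QQ_zero (A := 0) (B := 0) fun w => by simp).comb h1 a fun w => by simp [mul_assoc]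
    | mem x hx =>
      obtain ⟨l, rfl⟩ := hx
      exact QQ_word hZ l m

/-! ### Uniqueness -/

/-- tail estimate -/
lemma DS_tail {a : ℕ → ℝ} {C : ℝ} (hC : ∀ n, |a n| ≤ C) {m : ℕ} (h0 : ∀ n < m, a n = 0)
    {s : ℕ} {L : ℝ} (h : DSConv a (s + 2) L) :
    |L * ((m:ℝ) + 1) ^ (s + 2) - a m| ≤
      C * ((m:ℝ) + 1) ^ 2 * (∑' n : ℕ, 1 / ((n:ℝ) + 1) ^ 2) * (((m:ℝ) + 1) / ((m:ℝ) + 2)) ^ s := by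
  have hC0 : 0 ≤ C := (abs_nonneg _).trans (hC 0)
  have hs : Summable fun n : ℕ => 1 / ((n:ℝ) + 1) ^ 2 := by
    have := (summable_nat_add_iff 1).mpr (Real.summable_one_div_nat_pow.mpr one_lt_two)
    simpa using this
  have hm : (0:ℝ) < (m:ℝ) + 1 := by positivity
  set T := ∑' n : ℕ, 1 / ((n:ℝ) + 1) ^ 2
  have h1 := (h.mul_const (((m:ℝ) + 1) ^ (s + 2))).sub_const (a m)
  refine le_of_tendsto h1.abs ?_
  filter_upwards [eventually_gt_atTop m] with N hN
  have hmN : m ∈ Finset.range N := Finset.mem_range.mpr hN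
  rw [Finset.sum_mul, ← Finset.add_sum_erase _ _ hmN, div_mul_cancel₀ _ (by positivity),
    add_sub_cancel_left]
  refine (Finset.abs_sum_le_sum_abs _ _).trans ?_
  have hb : ∀ n ∈ (Finset.range N).erase m, |a n / ((n:ℝ) + 1) ^ (s + 2) * ((m:ℝ) + 1) ^ (s + 2)|
      ≤ C * ((m:ℝ) + 1) ^ 2 * (((m:ℝ) + 1) / ((m:ℝ) + 2)) ^ s * (1 / ((n:ℝ) + 1) ^ 2) := by
    intro n hn
    have hne := (Finset.mem_erase.mp hn).1
    rcases lt_or_gt_of_ne hne with hlt | hgt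
    · rw [h0 n hlt]
      simp only [zero_div, zero_mul, abs_zero]
      positivity
    · have hn1 : (m:ℝ) + 2 ≤ (n:ℝ) + 1 := by
        have : (m:ℝ) + 1 ≤ n := by exact_mod_cast hgt
        linarith
      have hn0 : (0:ℝ) < (n:ℝ) + 1 := by positivity
      have e : a n / ((n:ℝ) + 1) ^ (s + 2) * ((m:ℝ) + 1) ^ (s + 2)
          = a n * ((m:ℝ) + 1) ^ 2 * (((m:ℝ) + 1) / ((n:ℝ) + 1)) ^ s * (1 / ((n:ℝ) + 1) ^ 2) := by
        rw [div_pow]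
        field_simp
        ring
      rw [e, abs_mul, abs_mul, abs_mul, abs_of_nonneg (by positivity : 0 ≤ ((m:ℝ) + 1) ^ 2),
        abs_of_nonneg (by positivity : 0 ≤ (((m:ℝ) + 1) / ((n:ℝ) + 1)) ^ s),
        abs_of_nonneg (by positivity : 0 ≤ 1 / ((n:ℝ) + 1) ^ 2)]
      gcongr
      exact hC n
  refine (Finset.sum_le_sum hb).trans ?_
  rw [← Finset.mul_sum]
  calc _ ≤ C * ((m:ℝ) + 1) ^ 2 * (((m:ℝ) + 1) / ((m:ℝ) + 2)) ^ s * T := by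
        gcongr
        exact hs.sum_le_tsum _ fun n _ => by positivity
    _ = _ := by ring

lemma DS_bdd {a : ℕ → ℝ} {L : ℝ} (h : DSConv a 0 L) : ∃ C, ∀ n, |a n| ≤ C := by
  have h1 : Tendsto a atTop (𝓝 0) := by
    have h2 := (h.comp (tendsto_add_atTop_nat 1)).sub h
    rw [sub_self] at h2
    refine h2.congr fun n => ?_
    simp [Finset.sum_range_succ]
  obtain ⟨C, hC⟩ := h1.abs.bddAbove_range
  exact ⟨C, fun n => hC ⟨n, rfl⟩⟩

lemma DS_unique {a b : ℕ → ℝ} (h : ∀ s : ℕ, ∃ L M : ℝ, DSConv a s L ∧ DSConv b s M ∧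
    L + (s:ℝ) * M = 0) (n : ℕ) : a n = 0 ∧ b n = 0 := by
  induction n using Nat.strong_induction_on with
  | _ m ih =>
    choose L M hL hM hLM using h
    obtain ⟨Ca, hCa⟩ := DS_bdd (hL 0)
    obtain ⟨Cb, hCb⟩ := DS_bdd (hM 0)
    have ta := fun s => DS_tail hCa (fun n hn => (ih n hn).1) (hL (s + 2))
    have tb := fun s => DS_tail hCb (fun n hn => (ih n hn).2) (hM (s + 2))
    set T := ∑' n : ℕ, 1 / ((n:ℝ) + 1) ^ 2
    set Ka := Ca * ((m:ℝ) + 1) ^ 2 * T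
    set Kb := Cb * ((m:ℝ) + 1) ^ 2 * T
    set ρ := ((m:ℝ) + 1) / ((m:ℝ) + 2) with hρ
    have hρ0 : 0 ≤ ρ := by positivity
    have hρ1 : ρ < 1 := by rw [hρ, div_lt_one (by positivity)]; linarith
    have hb : ∀ s : ℕ, |a m + ((s:ℝ) + 2) * b m| ≤ Ka * ρ ^ s + ((s:ℝ) + 2) * (Kb * ρ ^ s) := by
      intro s
      have e : a m + ((s:ℝ) + 2) * b m = -(L (s + 2) * ((m:ℝ) + 1) ^ (s + 2) - a m)
          - ((s:ℝ) + 2) * (M (s + 2) * ((m:ℝ) + 1) ^ (s + 2) - b m) := by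
        have := hLM (s + 2)
        push_cast at this
        linear_combination ((m:ℝ) + 1) ^ (s + 2) * this
      rw [e]
      refine (abs_sub _ _).trans ?_
      rw [abs_neg, abs_mul, abs_of_nonneg (by positivity : (0:ℝ) ≤ (s:ℝ) + 2)]
      gcongr
      · exact ta s
      · exact tb s
    have l1 : Tendsto (fun s : ℕ => ρ ^ s) atTop (𝓝 0) := tendsto_pow_atTop_nhds_zero_of_lt_one hρ0 hρ1
    have l2 : Tendsto (fun s : ℕ => (s:ℝ) * ρ ^ s) atTop (𝓝 0) :=
      tendsto_self_mul_const_pow_of_lt_one hρ0 hρ1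
    have l3 : Tendsto (fun s : ℕ => Ka * ρ ^ s + ((s:ℝ) + 2) * (Kb * ρ ^ s)) atTop (𝓝 0) := by
      have := ((l1.const_mul Ka).add (l2.const_mul Kb)).add (l1.const_mul (2 * Kb))
      simp only [mul_zero, add_zero] at this
      exact this.congr fun s => by ring
    have l4 : Tendsto (fun s : ℕ => a m + ((s:ℝ) + 2) * b m) atTop (𝓝 0) :=
      squeeze_zero_norm hb l3
    have l5 := (l4.comp (tendsto_add_atTop_nat 1)).sub l4
    have b0 : b m = 0 := by
      refine tendsto_nhds_unique (tendsto_const_nhds.congr fun s => ?_) (by simpa using l5)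
      ring
    refine ⟨?_, b0⟩
    simp only [b0, mul_zero, add_zero] at l4
    exact tendsto_nhds_unique tendsto_const_nhds l4

end Parts

/-- For every `A ∈ yℌ` and `B ∈ ℌx`, there exist unique real
sequences `(a_n)_{n≥1}` and `(b_n)_{n≥1}` such that the Dirichlet series
`L₁(s) = ∑_{n≥1} a_n/n^s` and `L₂(s) = ∑_{n≥1} b_n/n^s` converge for every integer
`s ≥ 0` and `Z(A(x+y)^s B) = L₁(s) + s·L₂(s)` for every integer `s ≥ 0`. -/
theorem statement2 (Z : H →ₗ[ℚ] ℝ) (hZ : IsZetaMap Z)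
    (A B : H) (hA : ∃ w, A = Hy * w) (hB : ∃ w, B = w * Hx) :
    ∃! ab : (ℕ → ℝ) × (ℕ → ℝ),
      ∀ s : ℕ, ∃ L1 L2 : ℝ, DSConv ab.1 s L1 ∧ DSConv ab.2 s L2 ∧
        Z (A * (Hx + Hy) ^ s * B) = L1 + (s : ℝ) * L2 := by
  obtain ⟨v, rfl⟩ := hA
  obtain ⟨w, rfl⟩ := hB
  obtain ⟨ab, hab⟩ := QQ_all hZ v w
  refine ⟨ab, hab, fun cd hcd => ?_⟩
  have h : ∀ n, cd.1 n + (-1) * ab.1 n = 0 ∧ cd.2 n + (-1) * ab.2 n = 0 := by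
    refine DS_unique fun s => ?_
    obtain ⟨L, M, h1, h2, h3⟩ := hab s
    obtain ⟨L', M', h1', h2', h3'⟩ := hcd s
    refine ⟨_, _, h1'.add (h1.smul (-1)), h2'.add (h2.smul (-1)), ?_⟩
    linear_combination h3 - h3'
  refine Prod.ext (funext fun n => ?_) (funext fun n => ?_)
  · linarith [(h n).1]
  · linarith [(h n).2]

end
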